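/- Let m, n, k be integers with either (m ≥ 2, n ≥ 1, k ≥ 1) or (m = 1, n ≥ 2, k ≥ 2), and set d = m + n and s_{d,k} := d/2 − 1/k. There exist δ' > 0 and C > 0, depending only on m, n, k, such that for all dyadic integers N₁ ≥ N₂ ≥ ⋯ ≥ N_{k+1} ≥ 1 and all Fourier data g₁, …, g_{k+1} : ℝ^m×ℤⁿ → ℂ with gⱼ supported in {κ : |κ| ≤ 2Nⱼ, and moreover |κ| ≥ Nⱼ/2 when Nⱼ > 1}, the free waves uⱼ = U₁ gⱼ on ℝ^m×𝕋ⁿ satisfy the global-in-time bound ‖∏_{j=1}^{k+1} uⱼ‖_{L²(ℝ×ℝ^m×𝕋ⁿ)} ≤ C (N_{k+1}/N₁ + 1/N₂)^{δ'} ‖g₁‖_{L²} ∏_{j=2}^{k+1} Nⱼ^{s_{d,k}} ‖gⱼ‖_{L²}. -/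

import Mathlib

noncomputable section
open MeasureTheory
open scoped ENNReal NNReal Classical

/-- `|k|` for `k = (ζ, j/λ) ∈ ℝ^m × (1/λ)ℤⁿ`. -/
def freqNorm (lam : ℝ) {m n : ℕ} (ζ : Fin m → ℝ) (j : Fin n → ℤ) : ℝ :=
  Real.sqrt ((∑ i, (ζ i) ^ 2) + ∑ i, ((j i : ℝ) / lam) ^ 2)

/-- The free Schrödinger wave `(U_λ g)(t, x, y) = ∫ g(k) e^{i(z·k − t|k|²)} (dk)_λ`
on `ℝ^m × 𝕋ⁿ_λ`, where `g ζ j` stands for `g (ζ, j/λ)`. -/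
def waveU (lam : ℝ) {m n : ℕ} (g : (Fin m → ℝ) → (Fin n → ℤ) → ℂ)
    (t : ℝ) (x : Fin m → ℝ) (y : Fin n → ℝ) : ℂ :=
  ((1 / lam ^ n : ℝ) : ℂ) * ∑' j : Fin n → ℤ, ∫ ζ : Fin m → ℝ,
    g ζ j * Complex.exp (Complex.I *
      ((((∑ i, x i * ζ i) + ∑ i, y i * ((j i : ℝ) / lam))
        - t * ((∑ i, (ζ i) ^ 2) + ∑ i, ((j i : ℝ) / lam) ^ 2) : ℝ) : ℂ))

/-- Squared `L²_λ` norm of Fourier data on `ℝ^m × (1/λ)ℤⁿ`. -/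
def l2sq (lam : ℝ) {m n : ℕ} (g : (Fin m → ℝ) → (Fin n → ℤ) → ℂ) : ℝ≥0∞ :=
  ENNReal.ofReal (1 / lam ^ n) * ∑' j : Fin n → ℤ, ∫⁻ ζ : Fin m → ℝ, (‖g ζ j‖₊ : ℝ≥0∞) ^ 2

/-- `N` is a dyadic integer, i.e. `N ∈ 2^ℕ`. -/
def IsDyadic (N : ℝ) : Prop := ∃ a : ℕ, N = 2 ^ a

/-- `g` is supported in `{k : |k| ≤ 2N, and moreover |k| ≥ N/2 when N > 1}`. -/
def SuppIn (lam : ℝ) {m n : ℕ} (g : (Fin m → ℝ) → (Fin n → ℤ) → ℂ) (N : ℝ) : Prop :=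
  ∀ ζ j, g ζ j ≠ 0 → freqNorm lam ζ j ≤ 2 * N ∧ (1 < N → N / 2 ≤ freqNorm lam ζ j)

/-- One period box of the torus `𝕋ⁿ_λ`. -/
def torusBox (lam : ℝ) (n : ℕ) : Set (Fin n → ℝ) :=
  Set.Icc 0 (fun _ => 2 * Real.pi * lam)


lemma ennreal_mul_le_sq (a b : ℝ≥0∞) : a * b ≤ a ^ 2 + b ^ 2 := by
  rcases le_total a b with h | h
  · calc a * b ≤ b * b := by gcongr
      _ = b ^ 2 := by ring
      _ ≤ _ := le_add_self
  · calc a * b ≤ a * a := by gcongr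
      _ = a ^ 2 := by ring
      _ ≤ _ := le_self_add

/-- Schur test with a dominating symmetric kernel. -/
lemma schur_bound {Z Ω : Type*} [MeasurableSpace Z] [MeasurableSpace Ω] (ν : Measure Z)
    [IsFiniteMeasure ν] (μ : Measure Ω) [SFinite μ]
    (f : Ω → ℂ) (hf : Integrable f μ) (hfm : Measurable f)
    (e : Z → Ω → ℂ) (he : Measurable (fun p : Z × Ω => e p.1 p.2))
    (hb : ∀ z ω, ‖e z ω‖ ≤ 1)
    (S : Set Ω) (hS : MeasurableSet S) (hfS : ∀ ω, ω ∉ S → f ω = 0)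
    (K : Ω → Ω → ℝ≥0∞) (hKm : Measurable (fun p : Ω × Ω => K p.1 p.2))
    (hsymm : ∀ ω ω', K ω ω' = K ω' ω)
    (hK : ∀ ω ω', ‖∫ z, e z ω * (starRingEnd ℂ) (e z ω') ∂ν‖ₑ ≤ K ω ω')
    (M : ℝ≥0∞) (hM : ∀ ω, ∫⁻ ω' in S, K ω ω' ∂μ ≤ M) :
    ∫⁻ z, ‖∫ ω, f ω * e z ω ∂μ‖ₑ ^ 2 ∂ν ≤ 2 * M * ∫⁻ ω, ‖f ω‖ₑ ^ 2 ∂μ := by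
  set W : Z → ℂ := fun z => ∫ ω, f ω * e z ω ∂μ with hW
  have hWm : StronglyMeasurable W := by
    apply StronglyMeasurable.integral_prod_right (f := fun z ω => f ω * e z ω)
    apply Measurable.stronglyMeasurable
    exact (hfm.comp measurable_snd).mul he
  set G : Z → Ω × Ω → ℂ := fun z p =>
    (f p.1 * e z p.1) * (starRingEnd ℂ) (f p.2 * e z p.2) with hG
  have hGm : Measurable (fun q : Z × (Ω × Ω) => G q.1 q.2) := by
    have h1 : Measurable (fun q : Z × (Ω × Ω) => f q.2.1 * e q.1 q.2.1) :=
      (hfm.comp (measurable_fst.comp measurable_snd)).mul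
        (he.comp (measurable_fst.prodMk (measurable_fst.comp measurable_snd)))
    have h2 : Measurable (fun q : Z × (Ω × Ω) => f q.2.2 * e q.1 q.2.2) :=
      (hfm.comp (measurable_snd.comp measurable_snd)).mul
        (he.comp (measurable_fst.prodMk (measurable_snd.comp measurable_snd)))
    exact h1.mul (Complex.continuous_conj.measurable.comp h2)
  have hGi : Integrable (fun q : Z × (Ω × Ω) => G q.1 q.2) (ν.prod (μ.prod μ)) := by
    have h0 : Integrable (fun p : Ω × Ω => ‖f p.1‖ * ‖f p.2‖) (μ.prod μ) := hf.norm.mul_prod hf.norm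
    have h1 : Integrable (fun q : Z × (Ω × Ω) => (1 : ℝ) * (‖f q.2.1‖ * ‖f q.2.2‖))
        (ν.prod (μ.prod μ)) := (integrable_const (1 : ℝ)).mul_prod h0
    refine h1.mono' hGm.aestronglyMeasurable (Filter.Eventually.of_forall fun q => ?_)
    simp only [hG, norm_mul, RCLike.norm_conj, one_mul]
    have := hb q.1 q.2.1
    have := hb q.1 q.2.2
    calc ‖f q.2.1‖ * ‖e q.1 q.2.1‖ * (‖f q.2.2‖ * ‖e q.1 q.2.2‖)
        ≤ ‖f q.2.1‖ * 1 * (‖f q.2.2‖ * 1) := by gcongr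
      _ = _ := by ring
  have hWG : ∀ z, ((‖W z‖ ^ 2 : ℝ) : ℂ) = ∫ p, G z p ∂(μ.prod μ) := by
    intro z
    rw [hG]
    simp only
    rw [integral_prod_mul (fun ω => f ω * e z ω) (fun ω => (starRingEnd ℂ) (f ω * e z ω)),
      integral_conj, Complex.mul_conj, Complex.normSq_eq_norm_sq]
  have hWi : Integrable (fun z => ‖W z‖ ^ 2) ν := by
    have h1 : ∀ z, ‖W z‖ ≤ ∫ ω, ‖f ω‖ ∂μ := by
      intro z
      refine norm_integral_le_of_norm_le hf.norm (Filter.Eventually.of_forall fun ω => ?_)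
      rw [norm_mul]
      exact mul_le_of_le_one_right (norm_nonneg _) (hb z ω)
    refine Integrable.mono' (integrable_const ((∫ ω, ‖f ω‖ ∂μ) ^ 2))
      ((hWm.norm.pow 2).aestronglyMeasurable) (Filter.Eventually.of_forall fun z => ?_)
    rw [Real.norm_of_nonneg (by positivity)]
    have := h1 z
    gcongr
  have step1 : ∫⁻ z, ‖W z‖ₑ ^ 2 ∂ν = ‖∫ z, ((‖W z‖ ^ 2 : ℝ) : ℂ) ∂ν‖ₑ := by
    have hre : ∫ z, ((‖W z‖ ^ 2 : ℝ) : ℂ) ∂ν = ((∫ z, ‖W z‖ ^ 2 ∂ν : ℝ) : ℂ) := integral_ofReal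
    rw [hre]
    have h0 : 0 ≤ ∫ z, ‖W z‖ ^ 2 ∂ν := integral_nonneg fun z => by positivity
    rw [← ofReal_norm, Complex.norm_real, Real.norm_of_nonneg h0,
      ofReal_integral_eq_lintegral_ofReal hWi (Filter.Eventually.of_forall fun z => by positivity)]
    refine lintegral_congr fun z => ?_
    rw [ENNReal.ofReal_pow (norm_nonneg _), ofReal_norm]
  have step2 : ∫ z, ((‖W z‖ ^ 2 : ℝ) : ℂ) ∂ν = ∫ p, ∫ z, G z p ∂ν ∂(μ.prod μ) := by
    simp_rw [hWG]
    exact integral_integral_swap hGi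
  have step3 : ∀ p : Ω × Ω, ‖∫ z, G z p ∂ν‖ₑ ≤
      S.indicator (fun ω => ‖f p.1‖ₑ ^ 2 * K p.1 ω) p.2 +
      S.indicator (fun ω => ‖f p.2‖ₑ ^ 2 * K p.2 ω) p.1 := by
    intro p
    have hkey0 : ∫ z, G z p ∂ν = (f p.1 * (starRingEnd ℂ) (f p.2)) *
        ∫ z, e z p.1 * (starRingEnd ℂ) (e z p.2) ∂ν := by
      rw [← integral_const_mul]
      refine integral_congr_ae (Filter.Eventually.of_forall fun z => ?_)
      simp only [hG, map_mul]
      ring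
    by_cases h1 : p.1 ∈ S
    · by_cases h2 : p.2 ∈ S
      · rw [Set.indicator_of_mem h1, Set.indicator_of_mem h2, hkey0, enorm_mul, enorm_mul,
          RCLike.enorm_conj, hsymm p.2 p.1, ← add_mul]
        exact mul_le_mul' (ennreal_mul_le_sq _ _) (hK _ _)
      · rw [hkey0, hfS _ h2]; simp
    · rw [hkey0, hfS _ h1]; simp
  have hm1 : Measurable (fun p : Ω × Ω => S.indicator (fun ω => ‖f p.1‖ₑ ^ 2 * K p.1 ω) p.2) := by
    have : (fun p : Ω × Ω => S.indicator (fun ω => ‖f p.1‖ₑ ^ 2 * K p.1 ω) p.2) =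
      (Prod.snd ⁻¹' S).indicator (fun p : Ω × Ω => ‖f p.1‖ₑ ^ 2 * K p.1 p.2) := by
      ext p; simp [Set.indicator]
    rw [this]
    exact (((hfm.comp measurable_fst).enorm.pow_const 2).mul hKm).indicator (measurable_snd hS)
  have hm2 : Measurable (fun p : Ω × Ω => S.indicator (fun ω => ‖f p.2‖ₑ ^ 2 * K p.2 ω) p.1) :=
    hm1.comp measurable_swap
  have hX : ∀ ω, ∫⁻ ω', S.indicator (fun x => ‖f ω‖ₑ ^ 2 * K ω x) ω' ∂μ ≤ ‖f ω‖ₑ ^ 2 * M := by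
    intro ω
    have hK1 : Measurable (K ω) := hKm.comp (measurable_prodMk_left)
    rw [lintegral_indicator hS, lintegral_const_mul _ hK1]
    gcongr
    exact hM ω
  calc ∫⁻ z, ‖W z‖ₑ ^ 2 ∂ν = ‖∫ p, ∫ z, G z p ∂ν ∂(μ.prod μ)‖ₑ := by rw [step1, step2]
    _ ≤ ∫⁻ p, ‖∫ z, G z p ∂ν‖ₑ ∂(μ.prod μ) := enorm_integral_le_lintegral_enorm _
    _ ≤ ∫⁻ p, (S.indicator (fun ω => ‖f p.1‖ₑ ^ 2 * K p.1 ω) p.2 +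
      S.indicator (fun ω => ‖f p.2‖ₑ ^ 2 * K p.2 ω) p.1) ∂(μ.prod μ) := lintegral_mono step3
    _ = ∫⁻ p, S.indicator (fun ω => ‖f p.1‖ₑ ^ 2 * K p.1 ω) p.2 ∂(μ.prod μ) +
        ∫⁻ p, S.indicator (fun ω => ‖f p.2‖ₑ ^ 2 * K p.2 ω) p.1 ∂(μ.prod μ) :=
        lintegral_add_left hm1 _
    _ ≤ (∫⁻ ω, ‖f ω‖ₑ ^ 2 * M ∂μ) + ∫⁻ ω, ‖f ω‖ₑ ^ 2 * M ∂μ := by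
        rw [lintegral_prod _ hm1.aemeasurable, lintegral_prod_symm _ hm2.aemeasurable]
        exact add_le_add (lintegral_mono hX) (lintegral_mono hX)
    _ = 2 * M * ∫⁻ ω, ‖f ω‖ₑ ^ 2 ∂μ := by
        rw [lintegral_mul_const _ (hfm.enorm.pow_const 2)]
        ring


/-- normalised gaussian kernel -/
def gk (ε s : ℝ) : ℝ := Real.sqrt (Real.pi / ε) * Real.exp (-s ^ 2 / (4 * ε))

lemma gk_nonneg (ε s : ℝ) : 0 ≤ gk ε s := by unfold gk; positivity

lemma gk_symm (ε a b : ℝ) : gk ε (a - b) = gk ε (b - a) := by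
  unfold gk; congr 3; ring

lemma gk_meas (ε : ℝ) : Measurable (gk ε) := by unfold gk; fun_prop

lemma gk_integrable {ε : ℝ} (hε : 0 < ε) : Integrable (gk ε) := by
  have h := (integrable_exp_neg_mul_sq (b := 1 / (4 * ε)) (by positivity)).const_mul
    (Real.sqrt (Real.pi / ε))
  refine h.congr (Filter.Eventually.of_forall fun s => ?_)
  unfold gk
  simp only
  congr 2
  ring

lemma gk_integral {ε : ℝ} (hε : 0 < ε) : ∫ s, gk ε s = 2 * Real.pi := by
  have h := integral_gaussian (1 / (4 * ε))
  have h2 : ∀ s, gk ε s = Real.sqrt (Real.pi / ε) * Real.exp (-(1 / (4 * ε)) * s ^ 2) := by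
    intro s; unfold gk; congr 2; ring
  simp_rw [h2]
  rw [integral_const_mul, h, ← Real.sqrt_mul (by positivity)]
  rw [show Real.pi / ε * (Real.pi / (1 / (4 * ε))) = (2 * Real.pi) ^ 2 by field_simp; ring]
  exact Real.sqrt_sq (by positivity)

lemma gk_lintegral {ε : ℝ} (hε : 0 < ε) :
    ∫⁻ s, ENNReal.ofReal (gk ε s) = ENNReal.ofReal (2 * Real.pi) := by
  rw [← gk_integral hε, ofReal_integral_eq_lintegral_ofReal (gk_integrable hε)
    (Filter.Eventually.of_forall (gk_nonneg ε))]

lemma gk_lintegral_pi {ε : ℝ} (hε : 0 < ε) (m : ℕ) (ξ : Fin m → ℝ) :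
    ∫⁻ ζ : Fin m → ℝ, ENNReal.ofReal (∏ i, gk ε (ζ i - ξ i)) = ENNReal.ofReal ((2 * Real.pi) ^ m) := by
  have hi : ∀ i : Fin m, Integrable (fun s => gk ε (s - ξ i)) := fun i =>
    (gk_integrable hε).comp_sub_right (ξ i)
  have h1 : Integrable (fun ζ : Fin m → ℝ => ∏ i, gk ε (ζ i - ξ i)) :=
    Integrable.fintype_prod (f := fun i s => gk ε (s - ξ i)) hi
  rw [← ofReal_integral_eq_lintegral_ofReal h1
    (Filter.Eventually.of_forall fun ζ => Finset.prod_nonneg fun i _ => gk_nonneg _ _)]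
  rw [integral_fintype_prod_volume_eq_prod (fun i s => gk ε (s - ξ i))]
  simp_rw [integral_sub_right_eq_self (gk ε), gk_integral hε]
  simp

lemma norm_gauss_factor {ε : ℝ} (hε : 0 < ε) (a : ℝ) :
    ‖((Real.pi : ℂ) / (ε : ℂ)) ^ (1 / 2 : ℂ) * Complex.exp ((Complex.I * a) ^ 2 / (4 * (ε : ℂ)))‖
      = gk ε a := by
  rw [norm_mul]
  unfold gk
  congr 1
  · rw [← Complex.ofReal_div, Complex.norm_cpow_eq_rpow_re_of_pos (by positivity), Real.sqrt_eq_rpow]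
    norm_num
  · rw [Complex.norm_exp]
    congr 1
    rw [show (Complex.I * a) ^ 2 / (4 * (ε : ℂ)) = ((-a ^ 2 / (4 * ε) : ℝ) : ℂ) by
      push_cast; rw [mul_pow, Complex.I_sq]; ring]
    exact Complex.ofReal_re _

lemma gauss_pi {ε : ℝ} (hε : 0 < ε) (m : ℕ) (a : Fin m → ℝ) :
    ‖∫ x : Fin m → ℝ, ((Real.exp (-ε * ∑ i, x i ^ 2) : ℝ) : ℂ) *
      Complex.exp (Complex.I * ((∑ i, x i * a i : ℝ) : ℂ))‖ = ∏ i, gk ε (a i) := by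
  have h := GaussianFourier.integral_cexp_neg_sum_mul_add (ι := Fin m) (b := fun _ => (ε : ℂ))
    (by simpa using fun _ => hε) (fun i => Complex.I * a i)
  have : ∫ x : Fin m → ℝ, ((Real.exp (-ε * ∑ i, x i ^ 2) : ℝ) : ℂ) *
      Complex.exp (Complex.I * ((∑ i, x i * a i : ℝ) : ℂ)) =
      ∏ i, ((Real.pi : ℂ) / (ε : ℂ)) ^ (1 / 2 : ℂ) * Complex.exp ((Complex.I * a i) ^ 2 / (4 * (ε : ℂ))) := by
    rw [← h]
    refine integral_congr_ae (Filter.Eventually.of_forall fun x => ?_)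
    simp only
    rw [Complex.ofReal_exp, ← Complex.exp_add]
    congr 1
    push_cast
    rw [Finset.mul_sum, Finset.mul_sum, ← Finset.sum_neg_distrib]
    congr 1
    · exact Finset.sum_congr rfl fun i _ => by ring
    · exact Finset.sum_congr rfl fun i _ => by ring
  rw [this, norm_prod]
  exact Finset.prod_congr rfl fun i _ => norm_gauss_factor hε _

lemma gauss_one {ε : ℝ} (hε : 0 < ε) (a : ℝ) :
    ‖∫ t : ℝ, ((Real.exp (-ε * t ^ 2) : ℝ) : ℂ) *
      Complex.exp (Complex.I * ((-(t * a) : ℝ) : ℂ))‖ = gk ε a := by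
  have h := fourierIntegral_gaussian (b := (ε : ℂ)) (by simpa using hε) (-a : ℂ)
  rw [← norm_gauss_factor hε a]
  rw [show (Complex.I * (a : ℂ)) ^ 2 = -(-(a : ℂ)) ^ 2 by rw [mul_pow, Complex.I_sq]; ring, ← h]
  congr 1
  refine integral_congr_ae (Filter.Eventually.of_forall fun x => ?_)
  simp only
  rw [Complex.ofReal_exp, mul_comm]
  push_cast
  congr 2
  ring

lemma torus_one (D : ℤ) :
    ∫ y in Set.Icc (0 : ℝ) (2 * Real.pi), Complex.exp (Complex.I * ((y * D : ℝ) : ℂ)) =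
      if D = 0 then ((2 * Real.pi : ℝ) : ℂ) else 0 := by
  have hpi : (0 : ℝ) ≤ 2 * Real.pi := by positivity
  rw [integral_Icc_eq_integral_Ioc, ← intervalIntegral.integral_of_le hpi]
  split_ifs with h
  · subst h
    simp
  · have hc : (Complex.I * (D : ℂ)) ≠ 0 := mul_ne_zero Complex.I_ne_zero (by exact_mod_cast h)
    have := integral_exp_mul_complex (a := 0) (b := 2 * Real.pi) hc
    rw [show (fun y : ℝ => Complex.exp (Complex.I * ((y * D : ℝ) : ℂ))) =
      fun y : ℝ => Complex.exp (Complex.I * (D : ℂ) * y) by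
        ext y; congr 1; push_cast; ring, this]
    have h2 : Complex.exp (Complex.I * (D : ℂ) * ((2 * Real.pi : ℝ) : ℂ)) = 1 := by
      rw [Complex.exp_eq_one_iff]
      exact ⟨D, by push_cast; ring⟩
    rw [h2]; simp

lemma torus_pi (n : ℕ) (D : Fin n → ℤ) :
    ‖∫ y in Set.Icc (0 : Fin n → ℝ) (fun _ => 2 * Real.pi * 1),
      Complex.exp (Complex.I * ((∑ i, y i * (D i : ℝ) : ℝ) : ℂ))‖ =
      if D = 0 then (2 * Real.pi) ^ n else 0 := by
  have hset : Set.Icc (0 : Fin n → ℝ) (fun _ => 2 * Real.pi * 1) =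
      Set.pi Set.univ (fun _ => Set.Icc (0 : ℝ) (2 * Real.pi)) := by
    rw [← Set.pi_univ_Icc]; simp
  rw [hset, volume_pi, Measure.restrict_pi_pi]
  have : ∀ y : Fin n → ℝ, Complex.exp (Complex.I * ((∑ i, y i * (D i : ℝ) : ℝ) : ℂ)) =
      ∏ i, Complex.exp (Complex.I * ((y i * D i : ℝ) : ℂ)) := by
    intro y
    rw [← Complex.exp_sum]
    congr 1
    push_cast
    rw [Finset.mul_sum]
  simp_rw [this]
  rw [integral_fintype_prod_eq_prod (fun i s => Complex.exp (Complex.I * ((s * D i : ℝ) : ℂ)))]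
  simp_rw [torus_one]
  split_ifs with h
  · subst h
    simp [abs_of_pos Real.pi_pos]
  · obtain ⟨i, hi⟩ := Function.ne_iff.mp h
    rw [Finset.prod_eq_zero (Finset.mem_univ i)]
    · simp
    · simpa using hi


/-- frequency space -/
abbrev FX (m n : ℕ) : Type := (Fin m → ℝ) × (Fin n → ℤ)

/-- frequency measure -/
def muX (m n : ℕ) : Measure (FX m n) := (volume : Measure (Fin m → ℝ)).prod Measure.count

instance (m n : ℕ) : SFinite (muX m n) := by unfold muX; infer_instance
instance (m n : ℕ) : SigmaFinite (muX m n) := by unfold muX; infer_instance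
instance (m n : ℕ) : (muX m n).IsAddRightInvariant := by unfold muX; infer_instance

/-- space-time -/
abbrev ZZ (m n : ℕ) : Type := ℝ × ((Fin m → ℝ) × (Fin n → ℝ))

/-- space-time measure -/
def lamZ (m n : ℕ) : Measure (ZZ m n) :=
  (volume : Measure ℝ).prod ((volume : Measure (Fin m → ℝ)).prod
    ((volume : Measure (Fin n → ℝ)).restrict (Set.Icc (0 : Fin n → ℝ) (fun _ => 2 * Real.pi * 1))))

instance (m n : ℕ) : SFinite (lamZ m n) := by unfold lamZ; infer_instance

/-- plane wave -/
def ew {m n : ℕ} (z : ZZ m n) (κ : FX m n) (s : ℝ) : ℂ :=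
  Complex.exp (Complex.I * (((∑ i, z.2.1 i * κ.1 i) + ∑ i, z.2.2 i * (κ.2 i : ℝ)) - z.1 * s : ℝ))

lemma ew_norm {m n : ℕ} (z : ZZ m n) (κ : FX m n) (s : ℝ) : ‖ew z κ s‖ = 1 := by
  unfold ew; rw [mul_comm]; exact Complex.norm_exp_ofReal_mul_I _

lemma ew_add {m n : ℕ} (z : ZZ m n) (κ κ' : FX m n) (s s' : ℝ) :
    ew z (κ + κ') (s + s') = ew z κ s * ew z κ' s' := by
  unfold ew
  rw [← Complex.exp_add, ← mul_add, ← Complex.ofReal_add]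
  congr 3
  simp only [Prod.fst_add, Prod.snd_add, Pi.add_apply, Int.cast_add, mul_add, Finset.sum_add_distrib]
  ring

lemma ew_conj {m n : ℕ} (z : ZZ m n) (κ κ' : FX m n) (s s' : ℝ) :
    ew z κ s * (starRingEnd ℂ) (ew z κ' s') = ew z (κ - κ') (s - s') := by
  have h : (starRingEnd ℂ) (ew z κ' s') = ew z (-κ') (-s') := by
    unfold ew
    rw [← Complex.exp_conj, map_mul, Complex.conj_I, Complex.conj_ofReal, neg_mul, ← mul_neg,
      ← Complex.ofReal_neg]
    congr 3
    simp only [Prod.fst_neg, Prod.snd_neg, Pi.neg_apply, Int.cast_neg, mul_neg,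
      Finset.sum_neg_distrib]
    ring
  rw [h, ← ew_add, sub_eq_add_neg, sub_eq_add_neg]

lemma ew_meas {m n : ℕ} : Measurable (fun p : ZZ m n × (FX m n × ℝ) => ew p.1 p.2.1 p.2.2) := by
  unfold ew
  have h1 : ∀ i : Fin n, Measurable (fun p : ZZ m n × (FX m n × ℝ) => ((p.2.1.2 i : ℤ) : ℝ)) := by
    intro i
    exact (measurable_from_top (f := fun j : ℤ => (j : ℝ))).comp
      ((measurable_pi_apply i).comp (measurable_snd.comp (measurable_fst.comp measurable_snd)))
  apply Complex.measurable_exp.comp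
  apply Measurable.const_mul
  apply Complex.measurable_ofReal.comp
  refine Measurable.sub (Measurable.add ?_ ?_) ?_
  · fun_prop
  · refine Finset.measurable_sum _ fun i _ => ?_
    exact Measurable.mul (by fun_prop) (h1 i)
  · fun_prop

lemma ew_meas' {m n : ℕ} {A : Type*} [MeasurableSpace A] {a : A → ZZ m n} {b : A → FX m n} {c : A → ℝ}
    (ha : Measurable a) (hb : Measurable b) (hc : Measurable c) :
    Measurable (fun x => ew (a x) (b x) (c x)) :=
  Measurable.comp (g := fun p : ZZ m n × (FX m n × ℝ) => ew p.1 p.2.1 p.2.2)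
    (f := fun x => (a x, (b x, c x))) ew_meas (ha.prodMk (hb.prodMk hc))

/-- gaussian weight -/
def wZ {m n : ℕ} (ε : ℝ) (z : ZZ m n) : ℝ :=
  Real.exp (-ε * z.1 ^ 2) * (Real.exp (-ε * ∑ i, z.2.1 i ^ 2) * 1)

lemma wZ_nonneg {m n : ℕ} (ε : ℝ) (z : ZZ m n) : 0 ≤ wZ ε z := by unfold wZ; positivity

lemma wZ_meas {m n : ℕ} (ε : ℝ) : Measurable (wZ ε : ZZ m n → ℝ) := by
  unfold wZ; fun_prop

lemma wZ_int {m n : ℕ} {ε : ℝ} (hε : 0 < ε) : Integrable (wZ ε : ZZ m n → ℝ) (lamZ m n) := by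
  have h1 := integrable_exp_neg_mul_sq hε
  have h2 : Integrable (fun x : Fin m → ℝ => Real.exp (-ε * ∑ i, x i ^ 2)) := by
    have := Integrable.fintype_prod (ι := Fin m) (f := fun _ (s : ℝ) => Real.exp (-ε * s ^ 2))
      (μ := fun _ => volume) (fun _ => h1)
    refine this.congr (Filter.Eventually.of_forall fun x => ?_)
    simp only
    rw [← Real.exp_sum, Finset.mul_sum]
  have h3 : IsFiniteMeasure ((volume : Measure (Fin n → ℝ)).restrict
      (Set.Icc (0 : Fin n → ℝ) (fun _ => 2 * Real.pi * 1))) :=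
    ⟨by rw [Measure.restrict_apply_univ]; exact isCompact_Icc.measure_lt_top⟩
  have h4 : Integrable (fun _ : Fin n → ℝ => (1 : ℝ)) ((volume : Measure (Fin n → ℝ)).restrict
      (Set.Icc (0 : Fin n → ℝ) (fun _ => 2 * Real.pi * 1))) := integrable_const _
  exact h1.mul_prod (h2.mul_prod h4)

/-- the resulting kernel -/
def KK {m n : ℕ} (ε : ℝ) (κ κ' : FX m n) (s s' : ℝ) : ℝ≥0∞ :=
  ENNReal.ofReal (gk ε (s - s')) * (ENNReal.ofReal (∏ i, gk ε (κ.1 i - κ'.1 i)) *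
    (if κ.2 = κ'.2 then ENNReal.ofReal ((2 * Real.pi) ^ n) else 0))

lemma KK_symm {m n : ℕ} (ε : ℝ) (κ κ' : FX m n) (s s' : ℝ) : KK ε κ κ' s s' = KK ε κ' κ s' s := by
  unfold KK
  simp_rw [gk_symm ε s s', gk_symm ε (κ.1 _) (κ'.1 _), eq_comm (a := κ.2)]

lemma KK_eq {m n : ℕ} {ε : ℝ} (hε : 0 < ε) (κ κ' : FX m n) (s s' : ℝ) :
    ‖∫ z, ew z κ s * (starRingEnd ℂ) (ew z κ' s')
      ∂((lamZ m n).withDensity (fun z => ENNReal.ofReal (wZ ε z)))‖ₑ = KK ε κ κ' s s' := by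
  have h1 : ∫ z, ew z κ s * (starRingEnd ℂ) (ew z κ' s')
      ∂((lamZ m n).withDensity (fun z => ENNReal.ofReal (wZ ε z))) =
      ∫ z, (wZ ε z : ℂ) * ew z (κ - κ') (s - s') ∂(lamZ m n) := by
    simp_rw [ew_conj]
    have := integral_withDensity_eq_integral_smul (μ := lamZ m n)
      (f := fun z => (wZ ε z).toNNReal) (wZ_meas ε).real_toNNReal (fun z => ew z (κ - κ') (s - s'))
    refine this.trans (integral_congr_ae (Filter.Eventually.of_forall fun z => ?_))
    simp only [NNReal.smul_def, Real.coe_toNNReal _ (wZ_nonneg ε z), Complex.real_smul]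
  have h2 : ∀ z : ZZ m n, (wZ ε z : ℂ) * ew z (κ - κ') (s - s') =
      (((Real.exp (-ε * z.1 ^ 2) : ℝ) : ℂ) *
        Complex.exp (Complex.I * ((-(z.1 * (s - s')) : ℝ) : ℂ))) *
      ((((Real.exp (-ε * ∑ i, z.2.1 i ^ 2) : ℝ) : ℂ) *
      Complex.exp (Complex.I * ((∑ i, z.2.1 i * (κ - κ').1 i : ℝ) : ℂ))) *
      Complex.exp (Complex.I * ((∑ i, z.2.2 i * ((κ - κ').2 i : ℝ) : ℝ) : ℂ))) := by
    intro z
    unfold wZ ew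
    rw [show (((∑ i, z.2.1 i * (κ - κ').1 i) + ∑ i, z.2.2 i * ((κ - κ').2 i : ℝ)) -
      z.1 * (s - s') : ℝ) = -(z.1 * (s - s')) + ((∑ i, z.2.1 i * (κ - κ').1 i) +
        ∑ i, z.2.2 i * ((κ - κ').2 i : ℝ)) by ring]
    rw [Complex.ofReal_add (-(z.1 * (s - s'))), Complex.ofReal_add (∑ i, z.2.1 i * (κ - κ').1 i),
      mul_add, mul_add, Complex.exp_add, Complex.exp_add, Complex.ofReal_mul, Complex.ofReal_mul]
    simp only [Complex.ofReal_one]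
    ring
  rw [h1]
  simp_rw [h2]
  unfold lamZ
  rw [integral_prod_mul (fun t : ℝ => (((Real.exp (-ε * t ^ 2) : ℝ) : ℂ) *
        Complex.exp (Complex.I * ((-(t * (s - s')) : ℝ) : ℂ))))
      (fun q : (Fin m → ℝ) × (Fin n → ℝ) => ((((Real.exp (-ε * ∑ i, q.1 i ^ 2) : ℝ) : ℂ) *
      Complex.exp (Complex.I * ((∑ i, q.1 i * (κ - κ').1 i : ℝ) : ℂ))) *
      Complex.exp (Complex.I * ((∑ i, q.2 i * ((κ - κ').2 i : ℝ) : ℝ) : ℂ)))),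
    integral_prod_mul (fun x : Fin m → ℝ => (((Real.exp (-ε * ∑ i, x i ^ 2) : ℝ) : ℂ) *
      Complex.exp (Complex.I * ((∑ i, x i * (κ - κ').1 i : ℝ) : ℂ))))
      (fun y : Fin n → ℝ => Complex.exp (Complex.I * ((∑ i, y i * ((κ - κ').2 i : ℝ) : ℝ) : ℂ)))]
  rw [enorm_mul, enorm_mul, ← ofReal_norm, ← ofReal_norm, ← ofReal_norm, gauss_one hε, gauss_pi hε,
    torus_pi]
  unfold KK
  simp only [Prod.fst_sub, Prod.snd_sub, Pi.sub_apply, sub_eq_zero]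
  congr 2
  split_ifs <;> simp

lemma KK_meas {m n : ℕ} (ε : ℝ) :
    Measurable (fun p : (FX m n × ℝ) × (FX m n × ℝ) => KK ε p.1.1 p.2.1 p.1.2 p.2.2) := by
  unfold KK
  have hg := gk_meas ε
  refine Measurable.mul ?_ (Measurable.mul ?_ ?_)
  · exact ENNReal.measurable_ofReal.comp (hg.comp (by fun_prop))
  · refine ENNReal.measurable_ofReal.comp (Finset.measurable_prod _ fun i _ => hg.comp (by fun_prop))
  · refine Measurable.ite ?_ measurable_const measurable_const
    exact measurableSet_eq_fun (by fun_prop) (by fun_prop)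

lemma KK_meas' {m n : ℕ} (ε : ℝ) {A : Type*} [MeasurableSpace A] {a b : A → FX m n} {c d : A → ℝ}
    (ha : Measurable a) (hb : Measurable b) (hc : Measurable c) (hd : Measurable d) :
    Measurable (fun x => KK ε (a x) (b x) (c x) (d x)) :=
  Measurable.comp (g := fun p : (FX m n × ℝ) × (FX m n × ℝ) => KK ε p.1.1 p.2.1 p.1.2 p.2.2)
    (f := fun x => ((a x, c x), (b x, d x))) (KK_meas ε) ((ha.prodMk hc).prodMk (hb.prodMk hd))

set_option maxHeartbeats 1000000 in
/-- Abstract transference: level-set bound implies space-time `L²` bound. -/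
lemma core_bound {m n : ℕ} {Y : Type*} [MeasurableSpace Y] (μY : Measure Y) [SFinite μY]
    (T : Y → FX m n) (hT : Measurable T) (Φ : FX m n × Y → ℝ) (hΦ : Measurable Φ)
    (f : FX m n × Y → ℂ) (hf : Integrable f ((muX m n).prod μY)) (hfm : Measurable f)
    (S : Set (FX m n × Y)) (hS : MeasurableSet S) (hfS : ∀ ω, ω ∉ S → f ω = 0)
    (M : ℝ≥0∞)
    (hM : ∀ (κ : FX m n) (h : ℝ → ℝ≥0∞), Measurable h →
      ∫⁻ y, S.indicator (fun ω => h (Φ ω)) (κ - T y, y) ∂μY ≤ M * ∫⁻ s, h s) :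
    ∫⁻ z, ‖∫ ω, f ω * ew z (ω.1 + T ω.2) (Φ ω) ∂((muX m n).prod μY)‖ₑ ^ 2 ∂(lamZ m n) ≤
      2 * (ENNReal.ofReal ((2 * Real.pi) ^ (m + n + 1)) * M) *
        ∫⁻ ω, ‖f ω‖ₑ ^ 2 ∂((muX m n).prod μY) := by
  set F : ZZ m n → ℝ≥0∞ := fun z => ‖∫ ω, f ω * ew z (ω.1 + T ω.2) (Φ ω) ∂((muX m n).prod μY)‖ₑ ^ 2
    with hF
  have hem : Measurable (fun p : ZZ m n × (FX m n × Y) => ew p.1 (p.2.1 + T p.2.2) (Φ p.2)) := by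
    exact ew_meas' measurable_fst
      ((measurable_fst.comp measurable_snd).add (hT.comp (measurable_snd.comp measurable_snd)))
      (hΦ.comp measurable_snd)
  have hFm : Measurable F := by
    refine Measurable.pow_const (Measurable.enorm ?_) 2
    apply StronglyMeasurable.measurable
    apply StronglyMeasurable.integral_prod_right
      (f := fun z (ω : FX m n × Y) => f ω * ew z (ω.1 + T ω.2) (Φ ω))
    exact ((hfm.comp measurable_snd).mul hem).stronglyMeasurable
  have hTs : Measurable (fun ω : FX m n × Y => ω.1 + T ω.2) :=
    measurable_fst.add (hT.comp measurable_snd)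
  have key : ∀ ε : ℝ, 0 < ε → ∫⁻ z, ENNReal.ofReal (wZ ε z) * F z ∂(lamZ m n) ≤
      2 * (ENNReal.ofReal ((2 * Real.pi) ^ (m + n + 1)) * M) *
        ∫⁻ ω, ‖f ω‖ₑ ^ 2 ∂((muX m n).prod μY) := by
    intro ε hε
    have hfin : IsFiniteMeasure ((lamZ m n).withDensity (fun z => ENNReal.ofReal (wZ ε z))) :=
      isFiniteMeasure_withDensity_ofReal (wZ_int hε).2
    have hKKm : Measurable (fun p : (FX m n × Y) × (FX m n × Y) =>
        KK ε (p.1.1 + T p.1.2) (p.2.1 + T p.2.2) (Φ p.1) (Φ p.2)) :=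
      KK_meas' ε (hTs.comp measurable_fst) (hTs.comp measurable_snd)
        (hΦ.comp measurable_fst) (hΦ.comp measurable_snd)
    have := schur_bound ((lamZ m n).withDensity (fun z => ENNReal.ofReal (wZ ε z)))
      ((muX m n).prod μY) f hf hfm (fun z ω => ew z (ω.1 + T ω.2) (Φ ω)) hem
      (fun z ω => (ew_norm _ _ _).le) S hS hfS
      (fun ω ω' => KK ε (ω.1 + T ω.2) (ω'.1 + T ω'.2) (Φ ω) (Φ ω'))
      hKKm
      (fun ω ω' => KK_symm _ _ _ _ _)
      (fun ω ω' => (KK_eq hε _ _ _ _).le)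
      (ENNReal.ofReal ((2 * Real.pi) ^ (m + n + 1)) * M) ?_
    · rw [lintegral_withDensity_eq_lintegral_mul _ (wZ_meas ε).ennreal_ofReal hFm] at this
      exact this
    · intro ω
      obtain ⟨κ₀, hκ₀⟩ : ∃ κ₀, κ₀ = ω.1 + T ω.2 := ⟨_, rfl⟩
      obtain ⟨s₀, hs₀⟩ : ∃ s₀, s₀ = Φ ω := ⟨_, rfl⟩
      rw [← hκ₀, ← hs₀, ← lintegral_indicator hS]
      set h : ℝ → ℝ≥0∞ := fun s => ENNReal.ofReal (gk ε (s₀ - s)) with hh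
      have hhm : Measurable h := ENNReal.measurable_ofReal.comp ((gk_meas ε).comp (by fun_prop))
      have hhi : ∫⁻ s, h s = ENNReal.ofReal (2 * Real.pi) := by
        rw [← gk_lintegral hε]
        simp only [hh]
        simp_rw [gk_symm ε s₀]
        exact lintegral_sub_right_eq_self (fun s => ENNReal.ofReal (gk ε s)) s₀
      set E : FX m n → ℝ≥0∞ := fun κ => ENNReal.ofReal (∏ i, gk ε (κ.1 i - κ₀.1 i)) *
        (if κ.2 = κ₀.2 then ENNReal.ofReal ((2 * Real.pi) ^ n) else 0) with hE
      have hEm : Measurable E := by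
        refine Measurable.mul ?_ ?_
        · exact ENNReal.measurable_ofReal.comp
            (Finset.measurable_prod _ fun i _ => (gk_meas ε).comp (by fun_prop))
        · exact Measurable.ite (measurableSet_eq_fun (by fun_prop) (by fun_prop))
            measurable_const measurable_const
      have hEi : ∫⁻ κ, E κ ∂(muX m n) = ENNReal.ofReal ((2 * Real.pi) ^ (m + n)) := by
        unfold muX
        rw [hE]
        rw [lintegral_prod_mul (f := fun ζ : Fin m → ℝ => ENNReal.ofReal (∏ i, gk ε (ζ i - κ₀.1 i)))
          (g := fun j : Fin n → ℤ => if j = κ₀.2 then ENNReal.ofReal ((2 * Real.pi) ^ n) else 0)]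
        · rw [gk_lintegral_pi hε, lintegral_count, tsum_ite_eq, ← ENNReal.ofReal_mul (by positivity),
            pow_add]
        · exact (ENNReal.measurable_ofReal.comp
            (Finset.measurable_prod _ fun i _ => (gk_meas ε).comp (by fun_prop))).aemeasurable
        · exact (measurable_of_countable _).aemeasurable
      have hIm : Measurable (S.indicator fun ω => h (Φ ω)) := (hhm.comp hΦ).indicator hS
      have e1 : ∀ ω' : FX m n × Y, S.indicator (fun a => KK ε κ₀ (a.1 + T a.2) s₀ (Φ a)) ω' =
          E (ω'.1 + T ω'.2) * S.indicator (fun ω => h (Φ ω)) ω' := by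
        intro ω'
        by_cases hm : ω' ∈ S
        · rw [Set.indicator_of_mem hm, Set.indicator_of_mem hm]
          simp only [KK, hE, hh]
          simp_rw [gk_symm ε (κ₀.1 _), eq_comm (a := κ₀.2)]
          ring
        · rw [Set.indicator_of_notMem hm, Set.indicator_of_notMem hm, mul_zero]
      have e0 : Measurable (fun ω' : FX m n × Y =>
          E (ω'.1 + T ω'.2) * S.indicator (fun ω => h (Φ ω)) ω') :=
        (hEm.comp hTs).mul hIm
      have e3 : Measurable (fun ω' : FX m n × Y =>
          E ω'.1 * S.indicator (fun ω => h (Φ ω)) (ω'.1 - T ω'.2, ω'.2)) :=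
        (hEm.comp measurable_fst).mul (hIm.comp
          ((measurable_fst.sub (hT.comp measurable_snd)).prodMk measurable_snd))
      calc ∫⁻ ω', S.indicator (fun a => KK ε κ₀ (a.1 + T a.2) s₀ (Φ a)) ω' ∂((muX m n).prod μY)
          = ∫⁻ ω', E (ω'.1 + T ω'.2) * S.indicator (fun ω => h (Φ ω)) ω' ∂((muX m n).prod μY) :=
            lintegral_congr e1
        _ = ∫⁻ y, ∫⁻ κ, E (κ + T y) * S.indicator (fun ω => h (Φ ω)) (κ, y) ∂(muX m n) ∂μY :=
            lintegral_prod_symm _ e0.aemeasurable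
        _ = ∫⁻ y, ∫⁻ κ, E κ * S.indicator (fun ω => h (Φ ω)) (κ - T y, y) ∂(muX m n) ∂μY := by
            refine lintegral_congr fun y => ?_
            rw [← lintegral_sub_right_eq_self _ (T y)]
            simp
        _ = ∫⁻ κ, ∫⁻ y, E κ * S.indicator (fun ω => h (Φ ω)) (κ - T y, y) ∂μY ∂(muX m n) := by
            rw [← lintegral_prod_symm _ e3.aemeasurable, lintegral_prod _ e3.aemeasurable]
        _ = ∫⁻ κ, E κ * ∫⁻ y, S.indicator (fun ω => h (Φ ω)) (κ - T y, y) ∂μY ∂(muX m n) := by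
            refine lintegral_congr fun κ => ?_
            exact lintegral_const_mul _ (hIm.comp ((measurable_const.sub hT).prodMk measurable_id))
        _ ≤ ∫⁻ κ, E κ * (M * ENNReal.ofReal (2 * Real.pi)) ∂(muX m n) := by
            refine lintegral_mono fun κ => ?_
            gcongr
            rw [← hhi]
            exact hM κ h hhm
        _ = ENNReal.ofReal ((2 * Real.pi) ^ (m + n + 1)) * M := by
            have hp : ENNReal.ofReal ((2 * Real.pi) ^ (m + n + 1)) =
                ENNReal.ofReal ((2 * Real.pi) ^ (m + n)) * ENNReal.ofReal (2 * Real.pi) := by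
              rw [← ENNReal.ofReal_mul (by positivity), pow_succ]
            rw [lintegral_mul_const _ hEm, hEi, hp, mul_comm M, mul_assoc]
  -- monotone convergence
  have hmono : ∀ z, ⨆ l : ℕ, ENNReal.ofReal (wZ (1 / ((l : ℝ) + 1)) z) * F z = F z := by
    intro z
    rw [← ENNReal.iSup_mul]
    have : ⨆ l : ℕ, ENNReal.ofReal (wZ (1 / ((l : ℝ) + 1)) z) = 1 := by
      apply le_antisymm
      · refine iSup_le fun l => ?_
        rw [ENNReal.ofReal_le_one]
        unfold wZ
        rw [mul_one, ← Real.exp_add, Real.exp_le_one_iff]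
        have h1 : 0 ≤ (1 / ((l : ℝ) + 1)) := by positivity
        have h2 : 0 ≤ ∑ i, z.2.1 i ^ 2 := Finset.sum_nonneg fun i _ => sq_nonneg _
        nlinarith [mul_nonneg h1 h2, mul_nonneg h1 (sq_nonneg z.1)]
      · have ht : Filter.Tendsto (fun l : ℕ => ENNReal.ofReal (wZ (1 / ((l : ℝ) + 1)) z))
            Filter.atTop (nhds (ENNReal.ofReal (wZ 0 z))) := by
          have hc : Continuous (fun ε => ENNReal.ofReal (wZ ε z)) := by
            refine ENNReal.continuous_ofReal.comp ?_
            unfold wZ; fun_prop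
          exact (hc.tendsto 0).comp tendsto_one_div_add_atTop_nhds_zero_nat
        have h0 : wZ 0 z = 1 := by unfold wZ; simp
        rw [h0, ENNReal.ofReal_one] at ht
        exact le_of_tendsto' ht fun l => le_iSup (fun l : ℕ => ENNReal.ofReal (wZ (1 / ((l : ℝ) + 1)) z)) l
    rw [this, one_mul]
  calc ∫⁻ z, F z ∂(lamZ m n)
      = ∫⁻ z, ⨆ l : ℕ, ENNReal.ofReal (wZ (1 / ((l : ℝ) + 1)) z) * F z ∂(lamZ m n) :=
        lintegral_congr fun z => (hmono z).symm
    _ = ⨆ l : ℕ, ∫⁻ z, ENNReal.ofReal (wZ (1 / ((l : ℝ) + 1)) z) * F z ∂(lamZ m n) := by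
        refine lintegral_iSup (fun l => (wZ_meas _).ennreal_ofReal.mul hFm) ?_
        intro l l' hll z
        simp only
        gcongr
        unfold wZ
        have h2 : 0 ≤ ∑ i, z.2.1 i ^ 2 := Finset.sum_nonneg fun i _ => sq_nonneg _
        have h3 : 1 / ((l' : ℝ) + 1) ≤ 1 / ((l : ℝ) + 1) := by gcongr
        gcongr
    _ ≤ _ := iSup_le fun l => key _ (by positivity)


lemma cos_gap {a b : ℝ} (ha : a ∈ Set.Icc 0 Real.pi) (hb : b ∈ Set.Icc 0 Real.pi) :
    2 * ((a - b) / Real.pi) ^ 2 ≤ |Real.cos a - Real.cos b| := by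
  wlog hab : b ≤ a generalizing a b
  · have := this hb ha (le_of_not_ge hab)
    rw [abs_sub_comm]
    calc _ = 2 * ((b - a) / Real.pi) ^ 2 := by ring
      _ ≤ _ := this
  have hpi := Real.pi_pos
  obtain ⟨ha0, ha1⟩ := ha
  obtain ⟨hb0, hb1⟩ := hb
  have h1 : (a - b) / Real.pi ≤ Real.sin ((a - b) / 2) := by
    have := Real.mul_le_sin (x := (a - b) / 2) (by linarith) (by linarith)
    calc (a - b) / Real.pi = 2 / Real.pi * ((a - b) / 2) := by ring
      _ ≤ _ := this
  have h0 : 0 ≤ (a - b) / Real.pi := div_nonneg (by linarith) hpi.le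
  have h2 : Real.sin ((a - b) / 2) ≤ Real.sin ((a + b) / 2) := by
    have h := Real.sin_sub_sin ((a + b) / 2) ((a - b) / 2)
    rw [show ((a + b) / 2 - (a - b) / 2) / 2 = b / 2 by ring,
      show ((a + b) / 2 + (a - b) / 2) / 2 = a / 2 by ring] at h
    have h3 : 0 ≤ Real.sin (b / 2) := Real.sin_nonneg_of_nonneg_of_le_pi (by linarith) (by linarith)
    have h4 : 0 ≤ Real.cos (a / 2) := Real.cos_nonneg_of_neg_pi_div_two_le_of_le (by linarith) (by linarith)
    nlinarith [mul_nonneg h3 h4]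
  rw [Real.cos_sub_cos, abs_mul, abs_mul]
  rw [abs_of_nonneg (h0.trans h1), abs_of_nonneg (h0.trans (h1.trans h2))]
  norm_num
  nlinarith [mul_le_mul h1 h1 h0 (h0.trans h1)]

lemma arc_half {r L α : ℝ} (hr : 0 < r) (E : Set ℝ)
    (hE : ∀ θ ∈ E, |r * Real.cos θ - α| ≤ L) (hE2 : (E ⊆ Set.Icc 0 Real.pi) ∨ (E ⊆ Set.Icc (-Real.pi) 0)) :
    volume E ≤ ENNReal.ofReal (Real.pi * Real.sqrt (L / r)) := by
  have hpi := Real.pi_pos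
  refine (Real.volume_le_diam E).trans ?_
  refine Metric.ediam_le fun a ha b hb => ?_
  rw [edist_dist]
  apply ENNReal.ofReal_le_ofReal
  have gap : 2 * ((a - b) / Real.pi) ^ 2 ≤ |Real.cos a - Real.cos b| := by
    rcases hE2 with h | h
    · exact cos_gap (h ha) (h hb)
    · have h1 := h ha
      have h2 := h hb
      have := cos_gap (a := -a) (b := -b) ⟨by linarith [h1.2], by linarith [h1.1]⟩
        ⟨by linarith [h2.2], by linarith [h2.1]⟩
      rw [Real.cos_neg, Real.cos_neg] at this
      calc _ = 2 * ((-a - -b) / Real.pi) ^ 2 := by ring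
        _ ≤ _ := this
  have h1 := hE a ha
  have h2 := hE b hb
  have h3 : r * |Real.cos a - Real.cos b| ≤ 2 * L := by
    rw [show r * |Real.cos a - Real.cos b| = |r * (Real.cos a - Real.cos b)| by rw [abs_mul, abs_of_pos hr]]
    rw [abs_le] at *
    constructor <;> nlinarith
  have h4 : ((a - b) / Real.pi) ^ 2 ≤ L / r := by
    rw [le_div_iff₀ hr]
    nlinarith
  have h5 : |(a - b) / Real.pi| ≤ Real.sqrt (L / r) := Real.abs_le_sqrt h4
  rw [Real.dist_eq]
  rw [abs_div, abs_of_pos hpi, div_le_iff₀ hpi] at h5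
  linarith

lemma arc_full {r L α : ℝ} (hr : 0 < r) :
    volume {θ | θ ∈ Set.Ioo (-Real.pi) Real.pi ∧ |r * Real.cos θ - α| ≤ L} ≤
      ENNReal.ofReal (2 * Real.pi * Real.sqrt (L / r)) := by
  have hpi := Real.pi_pos
  have hsub : {θ | θ ∈ Set.Ioo (-Real.pi) Real.pi ∧ |r * Real.cos θ - α| ≤ L} ⊆
      {θ | θ ∈ Set.Icc 0 Real.pi ∧ |r * Real.cos θ - α| ≤ L} ∪
      {θ | θ ∈ Set.Icc (-Real.pi) 0 ∧ |r * Real.cos θ - α| ≤ L} := by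
    rintro θ ⟨⟨h1, h2⟩, h3⟩
    rcases le_total 0 θ with h | h
    · exact Or.inl ⟨⟨h, h2.le⟩, h3⟩
    · exact Or.inr ⟨⟨h1.le, h⟩, h3⟩
  refine (measure_mono hsub).trans ((measure_union_le _ _).trans ?_)
  rw [show 2 * Real.pi * Real.sqrt (L / r) = Real.pi * Real.sqrt (L / r) + Real.pi * Real.sqrt (L / r) by ring,
    ENNReal.ofReal_add (by positivity) (by positivity)]
  exact add_le_add (arc_half hr _ (fun θ h => h.2) (Or.inl fun θ h => h.1))
    (arc_half hr _ (fun θ h => h.2) (Or.inr fun θ h => h.1))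

lemma polar_sub (H : ℝ → ℝ≥0∞) (hH : Measurable H) :
    ∫⁻ r in Set.Ioi (0 : ℝ), ENNReal.ofReal r * H (r ^ 2) ≤ ∫⁻ s in Set.Ioi (0 : ℝ), H s := by
  have hinj : Set.InjOn (fun x : ℝ => x ^ 2) (Set.Ioi 0) := by
    intro a ha b hb hab
    exact (pow_left_inj₀ (le_of_lt ha) (le_of_lt hb) two_ne_zero).mp hab
  have h := lintegral_image_eq_lintegral_abs_deriv_mul (s := Set.Ioi (0 : ℝ)) (f := fun x => x ^ 2)
    (f' := fun x => 2 * x) measurableSet_Ioi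
    (fun x _ => by simpa using (hasDerivAt_pow 2 x).hasDerivWithinAt) hinj H
  have hsub : (fun x : ℝ => x ^ 2) '' (Set.Ioi 0) ⊆ Set.Ioi 0 := by
    rintro _ ⟨x, hx, rfl⟩
    exact pow_pos (Set.mem_Ioi.mp hx) 2
  calc ∫⁻ r in Set.Ioi (0 : ℝ), ENNReal.ofReal r * H (r ^ 2)
      ≤ ∫⁻ r in Set.Ioi (0 : ℝ), ENNReal.ofReal |2 * r| * H (r ^ 2) := by
        refine setLIntegral_mono' measurableSet_Ioi fun r hr => ?_
        have hr0 : 0 < r := hr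
        gcongr
        rw [abs_of_pos (by positivity)]; linarith
    _ = _ := h.symm
    _ ≤ _ := lintegral_mono_set hsub

lemma disc_bound {L ρ α : ℝ} (hρ : 0 < ρ) (hL : 0 ≤ L) (h : ℝ → ℝ≥0∞) (hh : Measurable h) :
    ∫⁻ p : ℝ × ℝ, {p : ℝ × ℝ | |p.1 - α| ≤ L}.indicator (fun p => h (p.1 ^ 2 + p.2 ^ 2)) p ≤
      ENNReal.ofReal (2 * Real.pi) * (ENNReal.ofReal (Real.sqrt (L / ρ)) * (∫⁻ s, h s) +
        ∫⁻ s in Set.Ico 0 (ρ ^ 2), h s) := by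
  have hpi := Real.pi_pos
  rw [← lintegral_comp_polarCoord_symm]
  have ht : polarCoord.target = Set.Ioi (0 : ℝ) ×ˢ Set.Ioo (-Real.pi) Real.pi := rfl
  have hmS : MeasurableSet {p : ℝ × ℝ | |p.1 - α| ≤ L} :=
    measurableSet_le (by fun_prop) measurable_const
  have hm0 : Measurable (fun p : ℝ × ℝ =>
      {p : ℝ × ℝ | |p.1 - α| ≤ L}.indicator (fun p => h (p.1 ^ 2 + p.2 ^ 2)) p) :=
    (hh.comp (by fun_prop)).indicator hmS
  have e1 : ∀ p : ℝ × ℝ, ENNReal.ofReal p.1 •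
      {p : ℝ × ℝ | |p.1 - α| ≤ L}.indicator (fun p => h (p.1 ^ 2 + p.2 ^ 2)) (polarCoord.symm p) =
      ENNReal.ofReal p.1 * h (p.1 ^ 2) * {θ | |p.1 * Real.cos θ - α| ≤ L}.indicator (fun _ => 1) p.2 := by
    intro p
    rw [polarCoord_symm_apply]
    have : (p.1 * Real.cos p.2) ^ 2 + (p.1 * Real.sin p.2) ^ 2 = p.1 ^ 2 := by
      have := Real.sin_sq_add_cos_sq p.2
      linear_combination p.1 ^ 2 * this
    simp only [Set.indicator, Set.mem_ofPred_eq, this, smul_eq_mul]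
    split_ifs <;> simp
  simp_rw [e1]
  have hm1 : Measurable (fun p : ℝ × ℝ => ENNReal.ofReal p.1 * h (p.1 ^ 2) *
      {θ | |p.1 * Real.cos θ - α| ≤ L}.indicator (fun _ => (1 : ℝ≥0∞)) p.2) := by
    refine Measurable.mul (Measurable.mul (by fun_prop) (hh.comp (by fun_prop))) ?_
    have : (fun p : ℝ × ℝ => {θ | |p.1 * Real.cos θ - α| ≤ L}.indicator (fun _ => (1 : ℝ≥0∞)) p.2) =
      {p : ℝ × ℝ | |p.1 * Real.cos p.2 - α| ≤ L}.indicator (fun _ => (1 : ℝ≥0∞)) := by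
      ext p; simp [Set.indicator]
    rw [this]
    exact measurable_const.indicator (measurableSet_le (by fun_prop) measurable_const)
  rw [ht, Measure.volume_eq_prod, ← Measure.prod_restrict, lintegral_prod _ hm1.aemeasurable]
  set H : ℝ → ℝ≥0∞ := fun s => h s * (ENNReal.ofReal (Real.sqrt (L / ρ)) +
    (Set.Ico 0 (ρ ^ 2)).indicator (fun _ => 1) s) with hH
  have hHm : Measurable H := hh.mul (Measurable.const_add (measurable_const.indicator measurableSet_Ico) _)
  have arc : ∀ r : ℝ, 0 < r → ∫⁻ θ in Set.Ioo (-Real.pi) Real.pi,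
      ENNReal.ofReal r * h (r ^ 2) * {θ | |r * Real.cos θ - α| ≤ L}.indicator (fun _ => 1) θ ≤
      ENNReal.ofReal (2 * Real.pi) * (ENNReal.ofReal r * H (r ^ 2)) := by
    intro r hr
    have hmr : MeasurableSet {θ | |r * Real.cos θ - α| ≤ L} :=
      measurableSet_le (by fun_prop) measurable_const
    rw [lintegral_const_mul _ (measurable_const.indicator hmr), lintegral_indicator hmr, setLIntegral_const,
      Measure.restrict_apply hmr, one_mul]
    have hb : volume ({θ | |r * Real.cos θ - α| ≤ L} ∩ Set.Ioo (-Real.pi) Real.pi) ≤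
        ENNReal.ofReal (2 * Real.pi) * (ENNReal.ofReal (Real.sqrt (L / ρ)) +
          (Set.Ico 0 (ρ ^ 2)).indicator (fun _ => 1) (r ^ 2)) := by
      by_cases hrρ : r < ρ
      · rw [Set.indicator_of_mem (show r ^ 2 ∈ Set.Ico 0 (ρ ^ 2) from ⟨by positivity, by gcongr⟩)]
        calc _ ≤ volume (Set.Ioo (-Real.pi) Real.pi) := measure_mono Set.inter_subset_right
          _ = ENNReal.ofReal (2 * Real.pi) * 1 := by rw [Real.volume_Ioo, mul_one]; congr 1; ring
          _ ≤ _ := by gcongr; exact le_add_self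
      · have hrρ' := not_lt.mp hrρ
        have := arc_full (r := r) (L := L) (α := α) hr
        calc _ = volume {θ | θ ∈ Set.Ioo (-Real.pi) Real.pi ∧ |r * Real.cos θ - α| ≤ L} := by
              congr 1; ext θ; simp [and_comm]
          _ ≤ _ := this
          _ ≤ ENNReal.ofReal (2 * Real.pi * Real.sqrt (L / ρ)) := by
              apply ENNReal.ofReal_le_ofReal
              gcongr
          _ = ENNReal.ofReal (2 * Real.pi) * ENNReal.ofReal (Real.sqrt (L / ρ)) :=
              ENNReal.ofReal_mul (by positivity)
          _ ≤ _ := by gcongr; exact le_self_add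
    calc _ ≤ ENNReal.ofReal r * h (r ^ 2) * (ENNReal.ofReal (2 * Real.pi) *
          (ENNReal.ofReal (Real.sqrt (L / ρ)) + (Set.Ico 0 (ρ ^ 2)).indicator (fun _ => 1) (r ^ 2))) := by
            gcongr
      _ = _ := by
          simp only [hH]
          generalize ENNReal.ofReal (2 * Real.pi) = A
          generalize (ENNReal.ofReal (Real.sqrt (L / ρ)) +
            (Set.Ico 0 (ρ ^ 2)).indicator (fun _ => 1) (r ^ 2)) = B
          ring
  calc _ ≤ ∫⁻ r in Set.Ioi (0 : ℝ), ENNReal.ofReal (2 * Real.pi) * (ENNReal.ofReal r * H (r ^ 2)) :=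
        setLIntegral_mono' measurableSet_Ioi fun r hr => arc r hr
    _ = ENNReal.ofReal (2 * Real.pi) * ∫⁻ r in Set.Ioi (0 : ℝ), (ENNReal.ofReal r * H (r ^ 2)) :=
        lintegral_const_mul _ (ENNReal.measurable_ofReal.mul (hHm.comp (by fun_prop)))
    _ ≤ ENNReal.ofReal (2 * Real.pi) * ∫⁻ s, H s := by
        exact mul_le_mul_right ((polar_sub H hHm).trans (setLIntegral_le_lintegral _ _)) _
    _ = _ := by
        congr 1
        simp only [hH, mul_add]
        rw [lintegral_add_left (hh.mul_const _), lintegral_mul_const _ hh, mul_comm]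
        congr 1
        rw [← lintegral_indicator measurableSet_Ico]
        refine lintegral_congr fun s => ?_
        simp [Set.indicator]

lemma scale_le {c : ℝ} (hc : 1 ≤ c) (F : ℝ → ℝ≥0∞) (hF : Measurable F) :
    ∫⁻ u, F (c * u) ≤ ∫⁻ u, F u := by
  have hc0 : 0 < c := by linarith
  have h := Real.map_volume_mul_left (a := c) hc0.ne'
  have h2 : ∫⁻ u, F (c * u) = ∫⁻ u, F u ∂(Measure.map (fun x => c * x) volume) :=
    (lintegral_map hF (by fun_prop)).symm
  rw [h2, h, lintegral_smul_measure]
  have : ENNReal.ofReal |c⁻¹| ≤ 1 := by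
    rw [ENNReal.ofReal_le_one, abs_of_pos (by positivity)]
    exact inv_le_one_of_one_le₀ hc
  calc _ ≤ 1 * ∫⁻ u, F u := by rw [smul_eq_mul]; gcongr
    _ = _ := one_mul _

/-- The two dimensional level set estimate. -/
lemma plane_bound {L ρ β γ η c P : ℝ} (hc1 : 1 ≤ c) (hc2 : c ≤ 2) (hρ : 0 < ρ) (hL : 0 ≤ L)
    (h : ℝ → ℝ≥0∞) (hh : Measurable h) :
    ∫⁻ v in Set.Icc (-L) L, ∫⁻ u : ℝ, h (2 * (u + β * v + γ) ^ 2 + c * (v + η) ^ 2 + P) ≤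
      ENNReal.ofReal (2 * Real.pi) * (ENNReal.ofReal (Real.sqrt (2 * L / ρ)) * (∫⁻ s, h s) +
        ∫⁻ s in Set.Ico P (P + ρ ^ 2), h s) := by
  set G : ℝ → ℝ≥0∞ := fun s => h (s + P) with hG
  have hGm : Measurable G := hh.comp (by fun_prop)
  set d := Real.sqrt c with hd
  have hd2 : d ^ 2 = c := Real.sq_sqrt (by linarith)
  have hd1 : 1 ≤ d := by rw [hd]; exact Real.one_le_sqrt.mpr hc1
  have hd3 : d ≤ 2 := by
    rw [hd, Real.sqrt_le_left (by norm_num)]; linarith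
  set D := Real.sqrt 2 with hD
  have hD2 : D ^ 2 = 2 := Real.sq_sqrt (by norm_num)
  have hD1 : 1 ≤ D := by rw [hD]; exact Real.one_le_sqrt.mpr (by norm_num)
  have i1 : ∀ v, ∫⁻ u : ℝ, h (2 * (u + β * v + γ) ^ 2 + c * (v + η) ^ 2 + P) ≤
      ∫⁻ u : ℝ, G ((d * (v + η)) ^ 2 + u ^ 2) := by
    intro v
    calc _ = ∫⁻ u : ℝ, G ((d * (v + η)) ^ 2 + (D * (u + (β * v + γ))) ^ 2) := by
          refine lintegral_congr fun u => ?_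
          simp only [hG, mul_pow, hd2, hD2]
          congr 1; ring
      _ = ∫⁻ u : ℝ, G ((d * (v + η)) ^ 2 + (D * u) ^ 2) :=
          lintegral_add_right_eq_self (fun u => G ((d * (v + η)) ^ 2 + (D * u) ^ 2)) _
      _ ≤ _ := scale_le hD1 (fun u => G ((d * (v + η)) ^ 2 + u ^ 2)) (hGm.comp (by fun_prop))
  set Q : ℝ → ℝ≥0∞ := fun a => ∫⁻ u : ℝ, G (a ^ 2 + u ^ 2) with hQ
  have hQm : Measurable Q := by
    have : Measurable (fun p : ℝ × ℝ => G (p.1 ^ 2 + p.2 ^ 2)) := hGm.comp (by fun_prop)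
    exact this.lintegral_prod_right'
  have hmA : MeasurableSet {a : ℝ | |a - d * η| ≤ 2 * L} :=
    measurableSet_le (by fun_prop) measurable_const
  calc _ ≤ ∫⁻ v in Set.Icc (-L) L, Q (d * (v + η)) := lintegral_mono fun v => i1 v
    _ = ∫⁻ v, (Set.Icc (-L) L).indicator (fun v => Q (d * (v + η))) v :=
        (lintegral_indicator measurableSet_Icc _).symm
    _ ≤ ∫⁻ v, {a : ℝ | |a - d * η| ≤ 2 * L}.indicator Q (d * (v + η)) := by
        refine lintegral_mono fun v => ?_
        by_cases hv : v ∈ Set.Icc (-L) L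
        · rw [Set.indicator_of_mem hv, Set.indicator_of_mem]
          simp only [Set.mem_ofPred_eq]
          rw [show d * (v + η) - d * η = d * v by ring, abs_mul, abs_of_nonneg (by linarith)]
          have : |v| ≤ L := abs_le.mpr hv
          nlinarith [abs_nonneg v]
        · rw [Set.indicator_of_notMem hv]; exact zero_le
    _ = ∫⁻ v, {a : ℝ | |a - d * η| ≤ 2 * L}.indicator Q (d * v) :=
        lintegral_add_right_eq_self (fun v => {a : ℝ | |a - d * η| ≤ 2 * L}.indicator Q (d * v)) _
    _ ≤ ∫⁻ a, {a : ℝ | |a - d * η| ≤ 2 * L}.indicator Q a := scale_le hd1 _ (hQm.indicator hmA)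
    _ = ∫⁻ p : ℝ × ℝ, {p : ℝ × ℝ | |p.1 - d * η| ≤ 2 * L}.indicator
          (fun p => G (p.1 ^ 2 + p.2 ^ 2)) p := by
        rw [Measure.volume_eq_prod, lintegral_prod]
        · refine lintegral_congr fun a => ?_
          by_cases ha : |a - d * η| ≤ 2 * L
          · simp [Set.indicator, ha, hQ]
          · simp [Set.indicator, ha]
        · refine (Measurable.indicator (hGm.comp (by fun_prop)) ?_).aemeasurable
          exact measurableSet_le (by fun_prop) measurable_const
    _ ≤ _ := disc_bound hρ (by linarith) G hGm
    _ = _ := by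
        congr 2
        · congr 1
          exact lintegral_add_right_eq_self h P
        · rw [← lintegral_indicator measurableSet_Ico, ← lintegral_indicator measurableSet_Ico,
            ← lintegral_add_right_eq_self ((Set.Ico P (P + ρ ^ 2)).indicator h) P]
          refine lintegral_congr fun s => ?_
          simp only [Set.indicator, hG, Set.mem_Ico]
          congr 1
          apply propext
          constructor <;> rintro ⟨h1, h2⟩ <;> constructor <;> linarith


lemma card_of_diam (F : Finset ℤ) (D : ℝ) (hD : 0 ≤ D)
    (h : ∀ x ∈ F, ∀ y ∈ F, |(x : ℝ) - y| ≤ D) : (F.card : ℝ) ≤ D + 1 := by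
  rcases F.eq_empty_or_nonempty with rfl | hne
  · simp; linarith
  have hx := F.min'_mem hne
  set x := F.min' hne
  have hsub : F ⊆ Finset.Icc x (x + ⌊D⌋) := by
    intro y hy
    rw [Finset.mem_Icc]
    have h1 : x ≤ y := F.min'_le y hy
    refine ⟨h1, ?_⟩
    have h2 := h y hy x hx
    have h3 : ((y - x : ℤ) : ℝ) ≤ D := by push_cast; exact (le_abs_self _).trans h2
    have := Int.le_floor.mpr h3
    linarith
  have h4 := Finset.card_le_card hsub
  rw [Int.card_Icc] at h4
  have h5 : (0 : ℤ) ≤ ⌊D⌋ := Int.floor_nonneg.mpr hD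
  have h6 : (F.card : ℤ) ≤ ⌊D⌋ + 1 := by omega
  have h7 : ((F.card : ℤ) : ℝ) ≤ ((⌊D⌋ + 1 : ℤ) : ℝ) := by exact_mod_cast h6
  push_cast at h7
  linarith [Int.floor_le D]

/-- one dimensional count, transversal case -/
lemma count_A (F : Finset ℤ) (b R ρ : ℝ) (hb : 0 < |b|) (hbR : 4 * R ≤ |b|)
    (hF : ∀ x ∈ F, |(x : ℝ)| ≤ R)
    (h : ∀ x ∈ F, ∀ y ∈ F, |((x : ℝ) ^ 2 + (b - x) ^ 2) - ((y : ℝ) ^ 2 + (b - y) ^ 2)| ≤ ρ ^ 2) :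
    (F.card : ℝ) ≤ ρ ^ 2 / |b| + 1 := by
  refine card_of_diam F _ (by positivity) fun x hx y hy => ?_
  have h1 := h x hx y hy
  rw [show ((x : ℝ) ^ 2 + (b - x) ^ 2) - ((y : ℝ) ^ 2 + (b - y) ^ 2) =
    2 * ((x - y) * (x + y - b)) by ring, abs_mul, abs_mul, abs_two] at h1
  have h2 : |b| / 2 ≤ |(x : ℝ) + y - b| := by
    have e1 : |b| ≤ |(x : ℝ) + y - b| + (|(x : ℝ)| + |(y : ℝ)|) := by
      calc |b| = |(-((x : ℝ) + y - b)) + (x + y)| := by congr 1; ring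
        _ ≤ _ := (abs_add_le _ _).trans (by rw [abs_neg]; gcongr; exact abs_add_le _ _)
    have := hF x hx
    have := hF y hy
    linarith
  rw [le_div_iff₀ hb]
  nlinarith [mul_le_mul_of_nonneg_left h2 (abs_nonneg ((x : ℝ) - y))]

/-- one dimensional count, general case -/
lemma count_B (F : Finset ℤ) (b ρ : ℝ) (hρ : 0 ≤ ρ)
    (h : ∀ x ∈ F, ∀ y ∈ F, |((x : ℝ) ^ 2 + (b - x) ^ 2) - ((y : ℝ) ^ 2 + (b - y) ^ 2)| ≤ ρ ^ 2) :
    (F.card : ℝ) ≤ 2 * ρ + 2 := by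
  have key : ∀ x ∈ F, ∀ y ∈ F, 0 ≤ (2 * x - b) * (2 * y - b) → |(x : ℝ) - y| ≤ ρ := by
    intro x hx y hy hxy
    have h1 := h x hx y hy
    rw [show ((x : ℝ) ^ 2 + (b - x) ^ 2) - ((y : ℝ) ^ 2 + (b - y) ^ 2) =
      2 * ((x - y) * (x + y - b)) by ring, abs_mul, abs_mul, abs_two] at h1
    have h2 : |(x : ℝ) - y| ≤ |(x : ℝ) + y - b| := by
      apply sq_le_sq.mp
      nlinarith
    have : |(x : ℝ) - y| ^ 2 ≤ ρ ^ 2 := by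
      nlinarith [mul_le_mul_of_nonneg_left h2 (abs_nonneg ((x : ℝ) - y)), abs_nonneg ((x : ℝ) - y)]
    exact (pow_le_pow_iff_left₀ (abs_nonneg _) hρ two_ne_zero).mp this
  have h1 : ((F.filter (fun x : ℤ => b ≤ 2 * x)).card : ℝ) ≤ ρ + 1 := by
    refine card_of_diam _ _ hρ fun x hx y hy => ?_
    rw [Finset.mem_filter] at hx hy
    exact key x hx.1 y hy.1 (mul_nonneg (by linarith [hx.2]) (by linarith [hy.2]))
  have h2 : ((F.filter (fun x : ℤ => ¬ b ≤ 2 * x)).card : ℝ) ≤ ρ + 1 := by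
    refine card_of_diam _ _ hρ fun x hx y hy => ?_
    rw [Finset.mem_filter] at hx hy
    exact key x hx.1 y hy.1 (mul_nonneg_of_nonpos_of_nonpos (by linarith [not_le.mp hx.2])
      (by linarith [not_le.mp hy.2]))
  have h3 := Finset.card_filter_add_card_filter_not (s := F) (fun x : ℤ => b ≤ 2 * x)
  have h4 : (F.card : ℝ) = ((F.filter (fun x : ℤ => b ≤ 2 * x)).card : ℝ) +
    ((F.filter (fun x : ℤ => ¬ b ≤ 2 * x)).card : ℝ) := by exact_mod_cast h3.symm
  linarith

lemma card_Icc_le {R : ℝ} (hR : 1 ≤ R) :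
    ((Finset.Icc (-⌊2 * R⌋) ⌊2 * R⌋).card : ℝ) ≤ 5 * R := by
  rw [Int.card_Icc]
  have h0 : (0 : ℤ) ≤ ⌊2 * R⌋ := Int.floor_nonneg.mpr (by linarith)
  have h1 : (((⌊2 * R⌋ + 1 - -⌊2 * R⌋).toNat : ℤ) : ℝ) = 2 * (⌊2 * R⌋ : ℝ) + 1 := by
    rw [Int.toNat_of_nonneg (by omega)]; push_cast; ring
  have h2 : (((⌊2 * R⌋ + 1 - -⌊2 * R⌋).toNat : ℕ) : ℝ) = 2 * (⌊2 * R⌋ : ℝ) + 1 := by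
    rw [← h1]; norm_cast
  rw [h2]
  linarith [Int.floor_le (2 * R)]

/-- The integer box of half-width `2R`. -/
def ibox (n : ℕ) (R : ℝ) : Finset (Fin n → ℤ) :=
  Fintype.piFinset fun _ => Finset.Icc (-⌊2 * R⌋) ⌊2 * R⌋

lemma mem_ibox {n : ℕ} {R : ℝ} {j : Fin n → ℤ} : j ∈ ibox n R ↔ ∀ a, |(j a : ℝ)| ≤ 2 * R := by
  unfold ibox
  rw [Fintype.mem_piFinset]
  refine forall_congr' fun a => ?_
  rw [Finset.mem_Icc, abs_le]
  constructor
  · rintro ⟨h1, h2⟩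
    rw [Int.le_floor] at h2
    have : -j a ≤ ⌊2 * R⌋ := by omega
    rw [Int.le_floor] at this
    push_cast at this
    exact ⟨by linarith, h2⟩
  · rintro ⟨h1, h2⟩
    have : -j a ≤ ⌊2 * R⌋ := by rw [Int.le_floor]; push_cast; linarith
    exact ⟨by omega, Int.le_floor.mpr h2⟩

lemma card_ibox {n : ℕ} {R : ℝ} (hR : 1 ≤ R) : ((ibox n R).card : ℝ) ≤ (5 * R) ^ n := by
  unfold ibox
  rw [Fintype.card_piFinset]
  push_cast
  calc _ ≤ ∏ _i : Fin n, (5 * R) := Finset.prod_le_prod (fun _ _ => by positivity) fun _ _ => card_Icc_le hR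
    _ = _ := by simp

lemma count_nd {n : ℕ} (i : Fin n) {R : ℝ} (hR : 1 ≤ R) (F : Finset (Fin n → ℤ)) (hF : F ⊆ ibox n R)
    (K : ℝ) (hK0 : 0 ≤ K)
    (hK : ∀ G ⊆ F, (∀ j ∈ G, ∀ j' ∈ G, ∀ a, a ≠ i → j a = j' a) → (G.card : ℝ) ≤ K) :
    (F.card : ℝ) ≤ K * (5 * R) ^ (n - 1) := by
  set f : (Fin n → ℤ) → (Fin n → ℤ) := fun j => Function.update j i 0 with hf
  have h1 : F.card ≤ ⌊K⌋₊ * (F.image f).card := by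
    refine Finset.card_le_mul_card_image F _ fun b hb => ?_
    refine Nat.le_floor (hK _ (Finset.filter_subset _ _) ?_)
    intro j hj j' hj' a ha
    rw [Finset.mem_filter] at hj hj'
    have := congrFun (hj.2.trans hj'.2.symm) a
    simpa [hf, Function.update_of_ne ha] using this
  have h2 : ((F.image f).card : ℝ) ≤ (5 * R) ^ (n - 1) := by
    have hsub : F.image f ⊆ Fintype.piFinset
        (fun a => if a = i then ({0} : Finset ℤ) else Finset.Icc (-⌊2 * R⌋) ⌊2 * R⌋) := by
      intro b hb
      rw [Finset.mem_image] at hb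
      obtain ⟨j, hj, rfl⟩ := hb
      rw [Fintype.mem_piFinset]
      intro a
      by_cases ha : a = i
      · subst ha; simp [hf]
      · have := hF hj
        unfold ibox at this
        rw [Fintype.mem_piFinset] at this
        simpa [hf, ha, Function.update_of_ne ha] using this a
    have h3 := Finset.card_le_card hsub
    rw [Fintype.card_piFinset, ← Finset.mul_prod_erase _ _ (Finset.mem_univ i)] at h3
    have h4 : ((F.image f).card : ℝ) ≤ ((∏ a ∈ Finset.univ.erase i,
      (if a = i then ({0} : Finset ℤ) else Finset.Icc (-⌊2 * R⌋) ⌊2 * R⌋).card : ℕ) : ℝ) := by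
      have : (if i = i then ({0} : Finset ℤ) else Finset.Icc (-⌊2 * R⌋) ⌊2 * R⌋).card = 1 := by simp
      rw [this, one_mul] at h3
      exact_mod_cast h3
    refine h4.trans ?_
    push_cast
    calc _ ≤ ∏ _a ∈ Finset.univ.erase i, (5 * R) := by
          refine Finset.prod_le_prod (fun _ _ => by positivity) fun a ha => ?_
          rw [if_neg (Finset.ne_of_mem_erase ha)]
          exact card_Icc_le hR
      _ = _ := by rw [Finset.prod_const, Finset.card_erase_of_mem (Finset.mem_univ i)]; simp
  calc (F.card : ℝ) ≤ (⌊K⌋₊ : ℝ) * ((F.image f).card : ℝ) := by exact_mod_cast h1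
    _ ≤ _ := by gcongr; exact Nat.floor_le hK0

/-- the window count -/
lemma count_window {n : ℕ} (i : Fin n) {R K1 ρ s : ℝ} (hR : 1 ≤ R) (hK1 : 0 ≤ K1) (hρ : 0 ≤ ρ)
    (B : Fin n → ℝ) (P : (Fin n → ℤ) → ℝ) (A : ℝ)
    (hP : ∀ j, P j = (∑ a, ((j a : ℝ) ^ 2 + (B a - j a) ^ 2)) + A)
    (hK : (8 * R ≤ |B i| ∧ ρ ^ 2 / |B i| + 1 ≤ K1) ∨ 2 * ρ + 2 ≤ K1) :
    (((ibox n R).filter fun j => P j ≤ s ∧ s < P j + ρ ^ 2).card : ℝ) ≤ K1 * (5 * R) ^ (n - 1) := by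
  refine count_nd i hR _ (Finset.filter_subset _ _) K1 hK1 ?_
  intro G hG hGi
  have hinj : Set.InjOn (fun j : Fin n → ℤ => j i) G := by
    intro j hj j' hj' hjj
    funext a
    by_cases ha : a = i
    · subst ha; exact hjj
    · exact hGi j hj j' hj' a ha
  rw [← Finset.card_image_of_injOn hinj]
  have hd : ∀ x ∈ G.image (fun j : Fin n → ℤ => j i), ∀ y ∈ G.image (fun j : Fin n → ℤ => j i),
      |((x : ℝ) ^ 2 + (B i - x) ^ 2) - ((y : ℝ) ^ 2 + (B i - y) ^ 2)| ≤ ρ ^ 2 := by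
    intro x hx y hy
    rw [Finset.mem_image] at hx hy
    obtain ⟨j, hj, rfl⟩ := hx
    obtain ⟨j', hj', rfl⟩ := hy
    have e1 := (Finset.mem_filter.mp (hG hj)).2
    have e2 := (Finset.mem_filter.mp (hG hj')).2
    have e3 : P j - P j' = ((j i : ℝ) ^ 2 + (B i - j i) ^ 2) - ((j' i : ℝ) ^ 2 + (B i - j' i) ^ 2) := by
      rw [hP, hP, ← Finset.add_sum_erase _ _ (Finset.mem_univ i),
        ← Finset.add_sum_erase (a := i) Finset.univ (fun a => ((j' a : ℝ) ^ 2 + (B a - j' a) ^ 2)) (Finset.mem_univ i)]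
      have : ∑ a ∈ Finset.univ.erase i, ((j a : ℝ) ^ 2 + (B a - j a) ^ 2) =
          ∑ a ∈ Finset.univ.erase i, ((j' a : ℝ) ^ 2 + (B a - j' a) ^ 2) := by
        refine Finset.sum_congr rfl fun a ha => ?_
        rw [hGi j hj j' hj' a (Finset.ne_of_mem_erase ha)]
      rw [this]; ring
    rw [← e3, abs_le]
    constructor <;> linarith [e1.1, e1.2, e2.1, e2.2]
  rcases hK with ⟨h1, h2⟩ | h1
  · refine (count_A _ (B i) (2 * R) ρ (by linarith) (by linarith) ?_ hd).trans h2
    intro x hx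
    rw [Finset.mem_image] at hx
    obtain ⟨j, hj, rfl⟩ := hx
    exact mem_ibox.mp (Finset.mem_filter.mp (hG hj)).1 i
  · exact (count_B _ (B i) ρ hρ hd).trans h1


/-- Summed plane bound. -/
lemma plane_sum {ι : Type*} (F : Finset ι) (P : ι → ℝ) {L ρ β γ η c K : ℝ} (hc1 : 1 ≤ c) (hc2 : c ≤ 2)
    (hρ : 0 < ρ) (hL : 0 ≤ L) (hK0 : 0 ≤ K)
    (hK : ρ ≤ |η| - L ∨ ∀ s, ((F.filter fun j => P j ≤ s ∧ s < P j + ρ ^ 2).card : ℝ) ≤ K)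
    (h : ℝ → ℝ≥0∞) (hh : Measurable h) :
    ∑ j ∈ F, ∫⁻ v in Set.Icc (-L) L, ∫⁻ u : ℝ, h (2 * (u + β * v + γ) ^ 2 + c * (v + η) ^ 2 + P j) ≤
      ENNReal.ofReal (2 * Real.pi * (F.card * Real.sqrt (2 * L / ρ) + K)) * ∫⁻ s, h s := by
  have hpi := Real.pi_pos
  rw [ENNReal.ofReal_mul (by positivity), ENNReal.ofReal_add (by positivity) hK0,
    ENNReal.ofReal_mul (p := (F.card : ℝ)) (by positivity), ENNReal.ofReal_natCast]
  rcases hK with hK | hK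
  · have key : ∀ j ∈ F, ∫⁻ v in Set.Icc (-L) L, ∫⁻ u : ℝ,
        h (2 * (u + β * v + γ) ^ 2 + c * (v + η) ^ 2 + P j) ≤
        ENNReal.ofReal (2 * Real.pi) * (ENNReal.ofReal (Real.sqrt (2 * L / ρ)) * ∫⁻ s, h s) := by
      intro j _
      set g : ℝ → ℝ≥0∞ := (Set.Ici (P j + ρ ^ 2)).indicator h with hg
      have hgm : Measurable g := hh.indicator measurableSet_Ici
      have h1 := plane_bound (L := L) (ρ := ρ) (β := β) (γ := γ) (η := η) (c := c) (P := P j) hc1 hc2 hρ hL g hgm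
      have h2 : ∫⁻ s in Set.Ico (P j) (P j + ρ ^ 2), g s = 0 := by
        rw [setLIntegral_congr_fun (g := fun _ => 0) measurableSet_Ico]
        · simp
        · intro s hs
          simp only [hg]
          rw [Set.indicator_of_notMem]
          simpa using hs.2
      rw [h2, add_zero] at h1
      calc _ = ∫⁻ v in Set.Icc (-L) L, ∫⁻ u : ℝ,
              g (2 * (u + β * v + γ) ^ 2 + c * (v + η) ^ 2 + P j) := by
            refine setLIntegral_congr_fun measurableSet_Icc fun v hv => ?_
            refine lintegral_congr fun u => ?_
            simp only [hg]
            rw [Set.indicator_of_mem]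
            rw [Set.mem_Ici]
            have hv' : |v| ≤ L := abs_le.mpr hv
            have e1 : ρ ≤ |v + η| := by
              have : |η| ≤ |v + η| + |v| := by
                calc |η| = |(v + η) + -v| := by congr 1; ring
                  _ ≤ _ := (abs_add_le _ _).trans (by rw [abs_neg])
              linarith
            have e2 : ρ ^ 2 ≤ (v + η) ^ 2 := by
              rw [← sq_abs (v + η)]; gcongr
            nlinarith [sq_nonneg (u + β * v + γ), sq_nonneg (v + η)]
        _ ≤ _ := h1
        _ ≤ _ := by
            gcongr with s
            exact Set.indicator_le_self _ _ _
    calc _ ≤ ∑ j ∈ F, ENNReal.ofReal (2 * Real.pi) * (ENNReal.ofReal (Real.sqrt (2 * L / ρ)) * ∫⁻ s, h s) :=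
          Finset.sum_le_sum key
      _ = ENNReal.ofReal (2 * Real.pi) * ((F.card : ℝ≥0∞) * ENNReal.ofReal (Real.sqrt (2 * L / ρ))) * ∫⁻ s, h s := by
          rw [Finset.sum_const, nsmul_eq_mul]; ring
      _ ≤ _ := by gcongr; exact le_self_add
  · calc _ ≤ ∑ j ∈ F, ENNReal.ofReal (2 * Real.pi) * (ENNReal.ofReal (Real.sqrt (2 * L / ρ)) * (∫⁻ s, h s) +
          ∫⁻ s in Set.Ico (P j) (P j + ρ ^ 2), h s) :=
          Finset.sum_le_sum fun j _ => plane_bound hc1 hc2 hρ hL h hh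
      _ = ENNReal.ofReal (2 * Real.pi) * ((F.card : ℝ≥0∞) * ENNReal.ofReal (Real.sqrt (2 * L / ρ)) * (∫⁻ s, h s) +
          ∑ j ∈ F, ∫⁻ s in Set.Ico (P j) (P j + ρ ^ 2), h s) := by
          rw [← Finset.mul_sum, Finset.sum_add_distrib, Finset.sum_const, nsmul_eq_mul, mul_assoc]
      _ ≤ ENNReal.ofReal (2 * Real.pi) * ((F.card : ℝ≥0∞) * ENNReal.ofReal (Real.sqrt (2 * L / ρ)) * (∫⁻ s, h s) +
          ENNReal.ofReal K * ∫⁻ s, h s) := by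
          gcongr
          calc _ = ∑ j ∈ F, ∫⁻ s, (Set.Ico (P j) (P j + ρ ^ 2)).indicator h s := by
                refine Finset.sum_congr rfl fun j _ => (lintegral_indicator measurableSet_Ico _).symm
            _ = ∫⁻ s, ∑ j ∈ F, (Set.Ico (P j) (P j + ρ ^ 2)).indicator h s :=
                (lintegral_finsetSum _ fun j _ => hh.indicator measurableSet_Ico).symm
            _ ≤ ∫⁻ s, ENNReal.ofReal K * h s := by
                refine lintegral_mono fun s => ?_
                have : ∑ j ∈ F, (Set.Ico (P j) (P j + ρ ^ 2)).indicator h s =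
                    ((F.filter fun j => P j ≤ s ∧ s < P j + ρ ^ 2).card : ℝ≥0∞) * h s := by
                  simp only [Set.indicator, Set.mem_Ico]
                  rw [← Finset.sum_filter, Finset.sum_const, nsmul_eq_mul]
                rw [this]
                gcongr
                rw [← ENNReal.ofReal_natCast]
                exact ENNReal.ofReal_le_ofReal (hK s)
            _ = _ := lintegral_const_mul _ hh
      _ = _ := by ring

lemma pi_split {m : ℕ} (q : Fin (m + 1)) (f : (Fin (m + 1) → ℝ) → ℝ≥0∞) (hf : Measurable f) :
    ∫⁻ ζ, f ζ = ∫⁻ ζ' : Fin m → ℝ, ∫⁻ u : ℝ, f (q.insertNth u ζ') := by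
  have h := (volume_preserving_piFinSuccAbove (fun _ : Fin (m + 1) => ℝ) q).symm
  rw [← h.lintegral_comp hf, Measure.volume_eq_prod, lintegral_prod_symm]
  · rfl
  · exact (hf.comp h.measurable).aemeasurable

lemma sum_lintegral_le {α ι : Type*} [MeasurableSpace α] (μ : Measure α) (F : Finset ι)
    (f : ι → α → ℝ≥0∞) : ∑ j ∈ F, ∫⁻ x, f j x ∂μ ≤ ∫⁻ x, ∑ j ∈ F, f j x ∂μ := by
  induction F using Finset.induction_on with
  | empty => simp
  | insert a s ha ih =>
    simp only [Finset.sum_insert ha]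
    exact (add_le_add le_rfl ih).trans (le_lintegral_add _ _)

lemma box_vol (m : ℕ) {L : ℝ} (hL : 0 ≤ L) :
    volume {w : Fin m → ℝ | ∀ a, |w a| ≤ L} ≤ ENNReal.ofReal ((2 * L) ^ m) := by
  have : {w : Fin m → ℝ | ∀ a, |w a| ≤ L} = Set.Icc (fun _ => -L) (fun _ => L) := by
    ext w
    simp only [Set.mem_ofPred_eq, Set.mem_Icc, Pi.le_def, abs_le]
    exact forall_and
  rw [this, Real.volume_Icc_pi]
  simp only [sub_neg_eq_add, Finset.prod_const, Finset.card_univ, Fintype.card_fin]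
  rw [← ENNReal.ofReal_pow (by linarith), two_mul]

lemma box_meas (m : ℕ) (L : ℝ) : MeasurableSet {w : Fin m → ℝ | ∀ a, |w a| ≤ L} := by
  simp only [Set.ofPred_forall]
  exact MeasurableSet.iInter fun a => measurableSet_le (by fun_prop) measurable_const

lemma lint_zero_le {α : Type*} [MeasurableSpace α] {μ : Measure α} {f : α → ℝ≥0∞} {b : ℝ≥0∞}
    (h : ∀ x, f x = 0) : ∫⁻ x, f x ∂μ ≤ b := by
  simp [h]

lemma bil_level {m : ℕ} {ι : Type*} (F : Finset ι) (A : ι → ℝ) (ξ : Fin (m + 2) → ℝ) (p : Fin (m + 2))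
    {L ρ K : ℝ} (hρ : 0 < ρ) (hL : 0 ≤ L) (hK0 : 0 ≤ K)
    (hK : ρ ≤ |ξ p| / 2 - L ∨ ∀ s, ((F.filter fun j => A j ≤ s ∧ s < A j + ρ ^ 2).card : ℝ) ≤ K)
    (h : ℝ → ℝ≥0∞) (hh : Measurable h) :
    ∑ j ∈ F, ∫⁻ ζ, {ζ : Fin (m + 2) → ℝ | ∀ a, |ζ a| ≤ L}.indicator
        (fun ζ => h ((∑ a, ((ξ a - ζ a) ^ 2 + ζ a ^ 2)) + A j)) ζ ≤
      ENNReal.ofReal ((2 * L) ^ m * (2 * Real.pi * (F.card * Real.sqrt (2 * L / ρ) + K))) * ∫⁻ s, h s := by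
  obtain ⟨q, hq⟩ : ∃ q : Fin (m + 2), q ≠ p := exists_ne p
  obtain ⟨p', hp'⟩ := Fin.exists_succAbove_eq hq.symm
  set P : (Fin m → ℝ) → ι → ℝ := fun w j => A j + ((ξ q) ^ 2 / 2 + (ξ p) ^ 2 / 2 +
    ∑ i, ((ξ (q.succAbove (p'.succAbove i)) - w i) ^ 2 + w i ^ 2)) with hP
  have key : ∀ j, ∫⁻ ζ, {ζ : Fin (m + 2) → ℝ | ∀ a, |ζ a| ≤ L}.indicator
        (fun ζ => h ((∑ a, ((ξ a - ζ a) ^ 2 + ζ a ^ 2)) + A j)) ζ ≤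
      ∫⁻ w in {w : Fin m → ℝ | ∀ a, |w a| ≤ L}, ∫⁻ v in Set.Icc (-L) L, ∫⁻ u : ℝ,
        h (2 * (u + 0 * v + -(ξ q) / 2) ^ 2 + 2 * (v + -(ξ p) / 2) ^ 2 + P w j) := by
    intro j
    have hm1 : Measurable ({ζ : Fin (m + 2) → ℝ | ∀ a, |ζ a| ≤ L}.indicator
        (fun ζ => h ((∑ a, ((ξ a - ζ a) ^ 2 + ζ a ^ 2)) + A j))) :=
      (hh.comp (by fun_prop)).indicator (box_meas _ _)
    rw [pi_split q _ hm1, pi_split p']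
    · rw [← lintegral_indicator (box_meas m L)]
      refine lintegral_mono fun w => ?_
      by_cases hw : ∀ a, |w a| ≤ L
      · rw [Set.indicator_of_mem (show w ∈ {w : Fin m → ℝ | ∀ a, |w a| ≤ L} from hw),
          ← lintegral_indicator measurableSet_Icc]
        refine lintegral_mono fun v => ?_
        by_cases hv : |v| ≤ L
        · rw [Set.indicator_of_mem (show v ∈ Set.Icc (-L) L from abs_le.mp hv)]
          refine lintegral_mono fun u => ?_
          refine (Set.indicator_le_self _ _ _).trans (le_of_eq ?_)
          congr 1
          rw [Fin.sum_univ_succAbove _ q]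
          simp only [Fin.insertNth_apply_same, Fin.insertNth_apply_succAbove]
          rw [Fin.sum_univ_succAbove _ p']
          simp only [Fin.insertNth_apply_same, Fin.insertNth_apply_succAbove, hp', hP]
          ring
        · refine lint_zero_le fun u => ?_
          rw [Set.indicator_of_notMem]
          intro hc
          apply hv
          have := hc (q.succAbove p')
          simpa using this
      · refine lint_zero_le fun v => ?_
        refine le_antisymm (lint_zero_le fun u => ?_) zero_le
        rw [Set.indicator_of_notMem]
        intro hc
        apply hw
        intro i
        have := hc (q.succAbove (p'.succAbove i))
        simpa using this
    · have : Measurable (fun z : (Fin (m + 1) → ℝ) × ℝ => ({ζ : Fin (m + 2) → ℝ | ∀ a, |ζ a| ≤ L}.indicator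
        (fun ζ => h ((∑ a, ((ξ a - ζ a) ^ 2 + ζ a ^ 2)) + A j)))
        (q.insertNth (α := fun _ => ℝ) z.2 z.1)) := by
        refine hm1.comp ?_
        have h := (volume_preserving_piFinSuccAbove (fun _ : Fin (m + 2) => ℝ) q).symm.measurable
        exact h.comp (measurable_snd.prodMk measurable_fst)
      exact this.lintegral_prod_right'
  calc _ ≤ ∑ j ∈ F, ∫⁻ w in {w : Fin m → ℝ | ∀ a, |w a| ≤ L}, ∫⁻ v in Set.Icc (-L) L, ∫⁻ u : ℝ,
        h (2 * (u + 0 * v + -(ξ q) / 2) ^ 2 + 2 * (v + -(ξ p) / 2) ^ 2 + P w j) :=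
        Finset.sum_le_sum fun j _ => key j
    _ ≤ ∫⁻ w in {w : Fin m → ℝ | ∀ a, |w a| ≤ L}, ∑ j ∈ F, ∫⁻ v in Set.Icc (-L) L, ∫⁻ u : ℝ,
        h (2 * (u + 0 * v + -(ξ q) / 2) ^ 2 + 2 * (v + -(ξ p) / 2) ^ 2 + P w j) :=
        sum_lintegral_le _ _ _
    _ ≤ ∫⁻ w in {w : Fin m → ℝ | ∀ a, |w a| ≤ L},
        ENNReal.ofReal (2 * Real.pi * (F.card * Real.sqrt (2 * L / ρ) + K)) * ∫⁻ s, h s := by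
        refine lintegral_mono fun w => ?_
        refine plane_sum F (P w) (by norm_num) le_rfl hρ hL hK0 ?_ h hh
        rcases hK with hK | hK
        · left
          rw [abs_div, abs_neg, abs_two]; exact hK
        · right
          intro s
          have := hK (s - ((ξ q) ^ 2 / 2 + (ξ p) ^ 2 / 2 +
            ∑ i, ((ξ (q.succAbove (p'.succAbove i)) - w i) ^ 2 + w i ^ 2)))
          convert this using 4 with j
          simp only [hP]
          constructor <;> rintro ⟨h1, h2⟩ <;> constructor <;> linarith
    _ = ENNReal.ofReal (2 * Real.pi * (F.card * Real.sqrt (2 * L / ρ) + K)) * (∫⁻ s, h s) *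
        volume {w : Fin m → ℝ | ∀ a, |w a| ≤ L} := setLIntegral_const _ _
    _ ≤ ENNReal.ofReal (2 * Real.pi * (F.card * Real.sqrt (2 * L / ρ) + K)) * (∫⁻ s, h s) *
        ENNReal.ofReal ((2 * L) ^ m) := by gcongr; exact box_vol m hL
    _ = _ := by
        rw [ENNReal.ofReal_mul (p := (2 * L) ^ m) (by positivity)]; ring


lemma tri_level {ι : Type*} (F : Finset ι) (A : ι → ℝ) (ξ : ℝ)
    {L ρ K : ℝ} (hρ : 0 < ρ) (hL : 0 ≤ L) (hK0 : 0 ≤ K)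
    (hK : ρ ≤ |ξ| / 3 - L ∨ ∀ s, ((F.filter fun j => A j ≤ s ∧ s < A j + ρ ^ 2).card : ℝ) ≤ K)
    (h : ℝ → ℝ≥0∞) (hh : Measurable h) :
    ∑ j ∈ F, ∫⁻ v in Set.Icc (-L) L, ∫⁻ u : ℝ, h (((ξ - (u + v)) ^ 2 + u ^ 2 + v ^ 2) + A j) ≤
      ENNReal.ofReal (2 * Real.pi * (F.card * Real.sqrt (2 * L / ρ) + K)) * ∫⁻ s, h s := by
  have h0 := plane_sum F (fun j => A j + ξ ^ 2 / 3) (L := L) (ρ := ρ) (β := 1 / 2) (γ := -ξ / 2)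
    (η := -ξ / 3) (c := 3 / 2) (K := K) (by norm_num) (by norm_num) hρ hL hK0 ?_ h hh
  · refine le_trans (le_of_eq ?_) h0
    refine Finset.sum_congr rfl fun j _ => ?_
    refine lintegral_congr fun v => lintegral_congr fun u => ?_
    congr 1; ring
  · rcases hK with hK | hK
    · left
      rw [abs_div, abs_neg, abs_of_pos (show (0 : ℝ) < 3 by norm_num)]; exact hK
    · right
      intro s
      convert hK (s - ξ ^ 2 / 3) using 4 with j
      constructor <;> rintro ⟨h1, h2⟩ <;> constructor <;> linarith

/-- squared frequency norm -/
def sqX {m n : ℕ} (κ : FX m n) : ℝ := (∑ i, (κ.1 i) ^ 2) + ∑ i, (κ.2 i : ℝ) ^ 2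

lemma sqX_nonneg {m n : ℕ} (κ : FX m n) : 0 ≤ sqX κ := by unfold sqX; positivity

lemma freqNorm_eq {m n : ℕ} (κ : FX m n) : freqNorm 1 κ.1 κ.2 = Real.sqrt (sqX κ) := by
  unfold freqNorm sqX; simp

lemma sqX_meas {m n : ℕ} : Measurable (sqX : FX m n → ℝ) := by
  unfold sqX
  have h1 : ∀ i : Fin n, Measurable (fun p : FX m n => ((p.2 i : ℤ) : ℝ)) := by
    intro i
    exact (measurable_from_top (f := fun j : ℤ => (j : ℝ))).comp
      ((measurable_pi_apply i).comp measurable_snd)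
  refine Measurable.add (by fun_prop) ?_
  exact Finset.measurable_sum _ fun i _ => (h1 i).pow_const 2

/-- support set -/
def suppX (m n : ℕ) (N : ℝ) : Set (FX m n) := {κ | sqX κ ≤ 4 * N ^ 2 ∧ (1 < N → N ^ 2 / 4 ≤ sqX κ)}

lemma suppX_meas (m n : ℕ) (N : ℝ) : MeasurableSet (suppX m n N) := by
  unfold suppX
  refine (measurableSet_le sqX_meas measurable_const).inter ?_
  by_cases hN : 1 < N
  · simp only [hN, true_imp_iff]
    exact measurableSet_le measurable_const sqX_meas
  · simp only [hN, false_imp_iff]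
    exact MeasurableSet.univ

lemma suppX_fst {m n : ℕ} {N : ℝ} (hN : 0 ≤ N) {κ : FX m n} (h : κ ∈ suppX m n N) (a : Fin m) :
    |κ.1 a| ≤ 2 * N := by
  have h1 : (κ.1 a) ^ 2 ≤ ∑ i, (κ.1 i) ^ 2 :=
    Finset.single_le_sum (f := fun i => (κ.1 i) ^ 2) (fun i _ => sq_nonneg _) (Finset.mem_univ a)
  have h2 : 0 ≤ ∑ i, (κ.2 i : ℝ) ^ 2 := by positivity
  have h3 := h.1
  unfold sqX at h3
  apply abs_le_of_sq_le_sq _ (by linarith)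
  nlinarith

lemma suppX_snd {m n : ℕ} {N : ℝ} (hN : 0 ≤ N) {κ : FX m n} (h : κ ∈ suppX m n N) :
    κ.2 ∈ ibox n N := by
  rw [mem_ibox]
  intro a
  have h1 : (κ.2 a : ℝ) ^ 2 ≤ ∑ i, (κ.2 i : ℝ) ^ 2 :=
    Finset.single_le_sum (f := fun i => (κ.2 i : ℝ) ^ 2) (fun i _ => sq_nonneg _) (Finset.mem_univ a)
  have h2 : 0 ≤ ∑ i, (κ.1 i : ℝ) ^ 2 := by positivity
  have h3 := h.1
  unfold sqX at h3
  apply abs_le_of_sq_le_sq _ (by linarith)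
  nlinarith

lemma muX_lint {m n : ℕ} (f : FX m n → ℝ≥0∞) (hf : Measurable f) :
    ∫⁻ y, f y ∂(muX m n) = ∑' j, ∫⁻ ζ, f (ζ, j) := by
  unfold muX
  rw [lintegral_prod_symm _ hf.aemeasurable, lintegral_count]

lemma coord_sel {m n : ℕ} (hd : 1 ≤ m + n) (κ : FX m n) {R : ℝ} (hR : 0 ≤ R) (h : R ^ 2 ≤ sqX κ) :
    (∃ p, R / (m + n) ≤ |κ.1 p|) ∨ ∃ i, R / (m + n) ≤ |(κ.2 i : ℝ)| := by
  by_contra hc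
  push Not at hc
  obtain ⟨h1, h2⟩ := hc
  have hd' : (1 : ℝ) ≤ (m : ℝ) + n := by exact_mod_cast hd
  set Q := (R / (m + n)) ^ 2 with hQ
  have hQR : ((m : ℝ) + n) * Q ≤ R ^ 2 := by
    rw [hQ, div_pow]
    rw [← mul_div_assoc, div_le_iff₀ (by positivity)]
    nlinarith [mul_nonneg (mul_nonneg (sq_nonneg R) (show 0 ≤ (m : ℝ) + n by linarith)) (sub_nonneg.mpr hd')]
  have e1 : ∀ i, (κ.1 i) ^ 2 < Q := fun i => by
    rw [hQ, ← sq_abs (κ.1 i)]; gcongr; exact h1 i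
  have e2 : ∀ i, (κ.2 i : ℝ) ^ 2 < Q := fun i => by
    rw [hQ, ← sq_abs (κ.2 i : ℝ)]; gcongr; exact h2 i
  have : sqX κ < ((m : ℝ) + n) * Q := by
    unfold sqX
    have s1 : ∑ i, (κ.1 i) ^ 2 ≤ m * Q := by
      calc _ ≤ ∑ _i : Fin m, Q := Finset.sum_le_sum fun i _ => (e1 i).le
        _ = _ := by simp
    have s2 : ∑ i, (κ.2 i : ℝ) ^ 2 ≤ n * Q := by
      calc _ ≤ ∑ _i : Fin n, Q := Finset.sum_le_sum fun i _ => (e2 i).le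
        _ = _ := by simp
    rcases Nat.eq_zero_or_pos m with hm | hm
    · have s3 : ∑ i, (κ.2 i : ℝ) ^ 2 < n * Q := by
        have : Nonempty (Fin n) := ⟨⟨0, by omega⟩⟩
        calc _ < ∑ _i : Fin n, Q := Finset.sum_lt_sum_of_nonempty Finset.univ_nonempty fun i _ => (e2 i)
          _ = _ := by simp
      linarith
    · have s3 : ∑ i, (κ.1 i : ℝ) ^ 2 < m * Q := by
        have : Nonempty (Fin m) := ⟨⟨0, by omega⟩⟩
        calc _ < ∑ _i : Fin m, Q := Finset.sum_lt_sum_of_nonempty Finset.univ_nonempty fun i _ => (e1 i)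
          _ = _ := by simp
      linarith
  linarith

/-- threshold -/
def cZ (d : ℝ) : ℝ := (48 * d) ^ 2
/-- counting constant -/
def cK (d : ℝ) : ℝ := 2 * cZ d + 8 * d + 2

lemma num_params {d N1 N2 N3 : ℝ} (hd : 1 ≤ d) (h3 : 1 ≤ N3) (h32 : N3 ≤ N2) (h21 : N2 ≤ N1) :
    ∃ ρ : ℝ, 0 < ρ ∧ Real.sqrt (2 * (2 * N3) / ρ) ≤ 2 * (N3 / N1 + 1 / N2) ^ (1 / 8 : ℝ) ∧
      (N1 < cZ d * N2 → 2 * ρ + 2 ≤ cK d * N2 * (N3 / N1 + 1 / N2) ^ (1 / 8 : ℝ)) ∧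
      (cZ d * N2 ≤ N1 → ρ ≤ N1 / 4 / d / 3 - 2 * N3 ∧ ∀ b : ℝ, N1 / 4 / d - 2 * N3 ≤ |b| →
        8 * N2 ≤ |b| ∧ ρ ^ 2 / |b| + 1 ≤ cK d * N2 * (N3 / N1 + 1 / N2) ^ (1 / 8 : ℝ)) := by
  have hN1 : 0 < N1 := by linarith
  have hN2 : 0 < N2 := by linarith
  have hN3 : 0 < N3 := by linarith
  set θ := (N3 / N1 + 1 / N2) ^ (1 / 8 : ℝ) with hθ
  set τ := (N3 / N1) ^ (1 / 8 : ℝ) with hτ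
  have hτ0 : 0 < τ := by positivity
  have hθ0 : 0 < θ := by positivity
  have hτθ : τ ≤ θ := by
    rw [hτ, hθ]; gcongr; linarith [show 0 < 1 / N2 by positivity]
  have hτ8 : τ ^ 8 = N3 / N1 := by
    rw [hτ, ← Real.rpow_natCast, ← Real.rpow_mul (by positivity)]; norm_num
  have hτ1 : τ ≤ 1 := by
    rw [hτ]
    refine Real.rpow_le_one (by positivity) ?_ (by norm_num)
    rw [div_le_one hN1]; linarith
  have h1N2 : 1 ≤ N2 * θ := by
    have e1 : 1 / N2 ≤ (1 / N2) ^ (1 / 8 : ℝ) := by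
      apply Real.self_le_rpow_of_le_one (by positivity)
      · rw [div_le_one hN2]; linarith
      · norm_num
    have e2 : (1 / N2) ^ (1 / 8 : ℝ) ≤ θ := by
      rw [hθ]; gcongr; linarith [show 0 < N3 / N1 by positivity]
    have := e1.trans e2
    rw [div_le_iff₀ hN2] at this
    linarith
  have hN3e : N3 = N1 * τ ^ 8 := by rw [hτ8]; field_simp
  have hcZ : 0 < cZ d := by unfold cZ; positivity
  refine ⟨N1 * τ ^ 6, by positivity, ?_, ?_, ?_⟩
  · rw [show 2 * (2 * N3) / (N1 * τ ^ 6) = (2 * τ) ^ 2 by rw [hN3e]; field_simp]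
    rw [Real.sqrt_sq (by positivity)]; linarith
  · intro hlt
    have e1 : N1 * τ ^ 6 ≤ cZ d * N2 * θ := by
      have : τ ^ 6 ≤ τ := by
        calc τ ^ 6 ≤ τ ^ 1 := pow_le_pow_of_le_one hτ0.le hτ1 (by norm_num)
          _ = τ := pow_one _
      have : τ ^ 6 ≤ θ := this.trans hτθ
      have := mul_le_mul hlt.le this (by positivity) (by positivity)
      linarith
    have e2 : 0 ≤ 8 * d * (N2 * θ) := by positivity
    unfold cK
    linarith
  · intro hge
    have hN2' : N2 ≤ N1 / cZ d := by rw [le_div_iff₀ hcZ]; linarith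
    have e0 : N1 / cZ d = N1 / (2304 * d * d) := by unfold cZ; congr 1; ring
    have e1 : N1 / (2304 * d * d) ≤ N1 / (2304 * d) := by
      apply div_le_div_of_nonneg_left hN1.le (by positivity)
      nlinarith
    have e2 : N2 ≤ N1 / d / 2304 := by
      rw [e0] at hN2'
      calc N2 ≤ N1 / (2304 * d) := hN2'.trans e1
        _ = _ := by field_simp
    have hq : 0 < N1 / d := by positivity
    refine ⟨?_, fun b hb => ?_⟩
    · have e3 : τ ^ 4 ≤ 1 / (48 * d) := by
        refine (pow_le_pow_iff_left₀ (by positivity) (by positivity) two_ne_zero).mp ?_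
        calc (τ ^ 4) ^ 2 = N3 / N1 := by rw [← hτ8]; ring
          _ ≤ (1 / (48 * d)) ^ 2 := by
              rw [div_le_iff₀ hN1]
              calc N3 ≤ N1 / cZ d := h32.trans hN2'
                _ = _ := by unfold cZ; field_simp
      have e4 : N1 * τ ^ 6 ≤ N1 / d / 48 := by
        calc N1 * τ ^ 6 ≤ N1 * τ ^ 4 := by
              gcongr ?_ * ?_
              exact pow_le_pow_of_le_one hτ0.le hτ1 (by norm_num)
          _ ≤ N1 * (1 / (48 * d)) := by gcongr
          _ = _ := by field_simp
      have : N1 / 4 / d / 3 = N1 / d / 12 := by field_simp; ring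
      rw [this]
      linarith
    · have e5 : N1 / 4 / d = N1 / d / 4 := by field_simp
      rw [e5] at hb
      have e6 : N1 / d / 8 ≤ |b| := by linarith
      refine ⟨by linarith, ?_⟩
      have hb0 : 0 < |b| := by linarith
      have e7 : (N1 * τ ^ 6) ^ 2 / |b| ≤ 8 * d * (N2 * θ) := by
        calc (N1 * τ ^ 6) ^ 2 / |b| ≤ (N1 * τ ^ 6) ^ 2 / (N1 / d / 8) := by gcongr
          _ = 8 * d * ((N1 * τ ^ 8) * τ ^ 4) := by field_simp
          _ ≤ 8 * d * (N2 * θ) := by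
              rw [← hN3e]
              gcongr
              calc τ ^ 4 ≤ τ ^ 1 := pow_le_pow_of_le_one hτ0.le hτ1 (by norm_num)
                _ = τ := pow_one _
                _ ≤ θ := hτθ
      unfold cK
      have : 0 ≤ 2 * cZ d * (N2 * θ) := by positivity
      linarith


lemma tsum_le_fin {ι : Type*} (F : Finset ι) (a b : ι → ℝ≥0∞) (h0 : ∀ j ∉ F, a j = 0)
    (h1 : ∀ j ∈ F, a j ≤ b j) : ∑' j, a j ≤ ∑ j ∈ F, b j := by
  rw [tsum_eq_sum (s := F) h0]
  exact Finset.sum_le_sum h1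

lemma sqX_sub_le {m n : ℕ} (κ y : FX m n) : sqX (κ - y) ≤ 2 * sqX κ + 2 * sqX y := by
  unfold sqX
  simp only [Prod.fst_sub, Prod.snd_sub, Pi.sub_apply, Int.cast_sub]
  have h1 : ∑ i, (κ.1 i - y.1 i) ^ 2 ≤ ∑ i, (2 * (κ.1 i) ^ 2 + 2 * (y.1 i) ^ 2) :=
    Finset.sum_le_sum fun i _ => by nlinarith [sq_nonneg (κ.1 i + y.1 i)]
  have h2 : ∑ i, ((κ.2 i : ℝ) - y.2 i) ^ 2 ≤ ∑ i, (2 * (κ.2 i : ℝ) ^ 2 + 2 * (y.2 i : ℝ) ^ 2) :=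
    Finset.sum_le_sum fun i _ => by nlinarith [sq_nonneg ((κ.2 i : ℝ) + y.2 i)]
  rw [Finset.sum_add_distrib, ← Finset.mul_sum, ← Finset.mul_sum] at h1 h2
  linarith

lemma sqX_add_le {m n : ℕ} (κ y : FX m n) : sqX (κ + y) ≤ 2 * sqX κ + 2 * sqX y := by
  have := sqX_sub_le κ (-y)
  have h : sqX (-y) = sqX y := by
    unfold sqX; simp
  rwa [sub_neg_eq_add, h] at this

lemma sqX_large {m n : ℕ} {κ T : FX m n} {N1 N2 d : ℝ} (hd : 1 ≤ d) (h2 : 1 ≤ N2)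
    (hge : cZ d * N2 ≤ N1) (hS : κ - T ∈ suppX m n N1) (hT : sqX T ≤ 16 * N2 ^ 2) :
    (N1 / 4) ^ 2 ≤ sqX κ := by
  have e1 : 2304 * N2 ≤ N1 := by
    refine le_trans ?_ hge
    unfold cZ
    have : (1 : ℝ) ≤ d ^ 2 := by nlinarith
    nlinarith
  have h3 := hS.2 (by linarith)
  have h4 := sqX_sub_le κ T
  nlinarith

lemma muX_lint_fin1 (f : (Fin 1 → ℝ) → ℝ≥0∞) (hf : Measurable f) :
    ∫⁻ ζ, f ζ = ∫⁻ v : ℝ, f (fun _ => v) := by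
  rw [pi_split 0 f hf, lintegral_unique]
  have h1 : (volume : Measure (Fin 0 → ℝ)) Set.univ = 1 := by
    rw [volume_pi, Measure.pi_univ]; simp
  rw [h1, mul_one]
  refine lintegral_congr fun u => ?_
  congr 1
  funext a
  have ha : a = 0 := by omega
  rw [ha, Fin.insertNth_apply_same]

lemma tri_int {n : ℕ} (Ψ : FX 1 n × FX 1 n → ℝ≥0∞) (hΨ : Measurable Ψ) (F2 F3 : Finset (Fin n → ℤ))
    (E : Set ℝ) (hE : MeasurableSet E) (q : ℝ → ℝ → (Fin n → ℤ) → (Fin n → ℤ) → ℝ≥0∞)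
    (hq : ∀ j2 j3, Measurable (fun p : ℝ × ℝ => q p.2 p.1 j2 j3))
    (h2 : ∀ y : FX 1 n × FX 1 n, y.1.2 ∉ F2 → Ψ y = 0) (h3 : ∀ y : FX 1 n × FX 1 n, y.2.2 ∉ F3 → Ψ y = 0)
    (hpw : ∀ u v j2 j3, Ψ ((fun _ => u, j2), (fun _ => v, j3)) ≤ E.indicator (fun v => q u v j2 j3) v) :
    ∫⁻ y, Ψ y ∂((muX 1 n).prod (muX 1 n)) ≤
      ∑ j3 ∈ F3, ∑ j2 ∈ F2, ∫⁻ v in E, ∫⁻ u, q u v j2 j3 := by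
  rw [lintegral_prod_symm _ hΨ.aemeasurable, muX_lint _ hΨ.lintegral_prod_left']
  refine tsum_le_fin _ _ _ (fun j3 hj => ?_) (fun j3 hj => ?_)
  · refine le_antisymm (lint_zero_le fun ζ => ?_) zero_le
    exact le_antisymm (lint_zero_le fun y2 => h3 (y2, (ζ, j3)) hj) zero_le
  have m1 : Measurable (fun p : (Fin 1 → ℝ) × FX 1 n => Ψ (p.2, (p.1, j3))) :=
      hΨ.comp (measurable_snd.prodMk (measurable_fst.prodMk measurable_const))
  have m1' := m1.lintegral_prod_right' (ν := muX 1 n)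
  rw [muX_lint_fin1 _ m1', ← lintegral_finsetSum]
  swap
  · intro j2 _
    exact (hq j2 j3).lintegral_prod_right'
  rw [← lintegral_indicator hE]
  refine lintegral_mono fun v => ?_
  have m2 : Measurable (fun y2 : FX 1 n => Ψ (y2, (fun _ => v, j3))) :=
    hΨ.comp (measurable_id.prodMk measurable_const)
  have m3 : ∀ j, Measurable (fun ζ : Fin 1 → ℝ => Ψ ((ζ, j), (fun _ => v, j3))) := fun j =>
    m2.comp (measurable_id.prodMk measurable_const)
  refine le_trans (le_of_eq (muX_lint _ m2)) ?_
  by_cases hv : v ∈ E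
  · rw [Set.indicator_of_mem hv]
    refine tsum_le_fin _ _ _ (fun j hj => ?_) (fun j hj => ?_)
    · exact le_antisymm (lint_zero_le fun ζ => h2 ((ζ, j), (fun _ => v, j3)) hj) zero_le
    · rw [muX_lint_fin1 _ (m3 j)]
      refine lintegral_mono fun u => ?_
      refine (hpw u v j j3).trans ?_
      rw [Set.indicator_of_mem hv]
  · rw [Set.indicator_of_notMem hv]
    refine le_of_eq ?_
    rw [ENNReal.tsum_eq_zero]
    intro j
    rw [muX_lint_fin1 _ (m3 j)]
    refine le_antisymm (lint_zero_le fun u => ?_) zero_le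
    refine le_antisymm ((hpw u v j j3).trans ?_) zero_le
    rw [Set.indicator_of_notMem hv]

/-- constant -/
def cB (a d : ℝ) (n : ℕ) : ℝ := a * (2 * Real.pi * (5 ^ n * (2 + cK d)))

lemma cB_bound {a b d N N2 θ q : ℝ} {n : ℕ} {c : ℕ} (hn : 1 ≤ n) (hd : 1 ≤ d) (hN2 : 1 ≤ N2)
    (hc : (c : ℝ) ≤ (5 * N2) ^ n) (hq0 : 0 ≤ q) (hq : q ≤ 2 * θ) (hθ : 0 ≤ θ) (ha : 0 ≤ a * N) (hb : b = a * N) :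
    b * (2 * Real.pi * (c * q + cK d * N2 * θ * (5 * N2) ^ (n - 1))) ≤
      cB a d n * (N * N2 ^ n) * θ := by
  have hcK : 0 ≤ cK d := by unfold cK cZ; positivity
  have e1 : N2 * (5 * N2) ^ (n - 1) ≤ (5 * N2) ^ n := by
    obtain ⟨n', rfl⟩ : ∃ n', n = n' + 1 := ⟨n - 1, by omega⟩
    simp only [Nat.add_sub_cancel]
    rw [pow_succ (5 * N2)]
    have : 0 ≤ (5 * N2) ^ n' := by positivity
    nlinarith
  have e2 : (c : ℝ) * q ≤ (5 * N2) ^ n * (2 * θ) := by gcongr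
  have e3 : cK d * N2 * θ * (5 * N2) ^ (n - 1) ≤ (5 * N2) ^ n * (cK d * θ) := by
    calc _ = (cK d * θ) * (N2 * (5 * N2) ^ (n - 1)) := by ring
      _ ≤ (cK d * θ) * (5 * N2) ^ n := by gcongr
      _ = _ := by ring
  calc _ ≤ b * (2 * Real.pi * ((5 * N2) ^ n * (2 * θ) + (5 * N2) ^ n * (cK d * θ))) := by
        rw [← hb] at ha
        gcongr
    _ = _ := by rw [hb, mul_pow]; unfold cB; ring

lemma bil_M {m n : ℕ} (hn : 1 ≤ n) {N1 N2 : ℝ} (h2 : 1 ≤ N2) (h21 : N2 ≤ N1) (κ : FX (m + 2) n)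
    (h : ℝ → ℝ≥0∞) (hh : Measurable h) :
    ∫⁻ y, (suppX (m + 2) n N1 ×ˢ suppX (m + 2) n N2).indicator (fun ω => h (sqX ω.1 + sqX ω.2))
        (κ - y, y) ∂(muX (m + 2) n) ≤
      ENNReal.ofReal (cB (4 ^ m) ((m + 2 : ℕ) + n) n * (N2 ^ m * N2 ^ n) * (N2 / N1 + 1 / N2) ^ (1 / 8 : ℝ)) * ∫⁻ s, h s := by
  set d : ℝ := ((m + 2 : ℕ) + n : ℝ) with hdd
  have hd : 1 ≤ d := by rw [hdd]; push_cast; linarith [Nat.cast_nonneg (α := ℝ) m, Nat.cast_nonneg (α := ℝ) n]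
  obtain ⟨ρ, hρ, hs, hA, hB⟩ := num_params hd h2 le_rfl h21
  set θ := (N2 / N1 + 1 / N2) ^ (1 / 8 : ℝ) with hθ
  have hN1' : 0 < N1 := by linarith
  have hN2' : 0 < N2 := by linarith
  have hθ0 : 0 ≤ θ := by positivity
  have hcK : 0 ≤ cK d := by unfold cK cZ; positivity
  set F := ibox n N2 with hF
  set A : (Fin n → ℤ) → ℝ := fun j => (∑ a, ((j a : ℝ) ^ 2 + ((κ.2 a : ℝ) - j a) ^ 2)) + 0 with hAdef
  by_cases hex : ∃ y, (κ - y, y) ∈ suppX (m + 2) n N1 ×ˢ suppX (m + 2) n N2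
  swap
  · push Not at hex
    exact lint_zero_le fun y => Set.indicator_of_notMem (hex y) _
  have hcl : ∃ p : Fin (m + 2), ρ ≤ |κ.1 p| / 2 - 2 * N2 ∨
      ∀ s, ((F.filter fun j => A j ≤ s ∧ s < A j + ρ ^ 2).card : ℝ) ≤ cK d * N2 * θ * (5 * N2) ^ (n - 1) := by
    rcases lt_or_ge N1 (cZ d * N2) with hlt | hge
    · refine ⟨0, Or.inr fun s => ?_⟩
      exact count_window ⟨0, hn⟩ h2 (by positivity) hρ.le (fun a => (κ.2 a : ℝ)) A 0 (fun j => rfl)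
        (Or.inr (hA hlt))
    · obtain ⟨y, hy1, hy2⟩ := hex
      have hl := sqX_large hd h2 hge hy1 (by have := hy2.1; simp only at this; nlinarith)
      obtain ⟨hB1, hB2⟩ := hB hge
      have hN1 : 0 ≤ N1 / 4 := by linarith
      rcases coord_sel (by omega) κ hN1 hl with ⟨p, hp⟩ | ⟨i, hi⟩
      · refine ⟨p, Or.inl ?_⟩
        have e1 : N1 / 4 / d ≤ |κ.1 p| := hp
        have e2 := abs_nonneg (κ.1 p)
        linarith
      · refine ⟨0, Or.inr fun s => ?_⟩
        have e1 : N1 / 4 / d ≤ |(κ.2 i : ℝ)| := hi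
        exact count_window i h2 (by positivity) hρ.le (fun a => (κ.2 a : ℝ)) A 0 (fun j => rfl)
          (Or.inl (hB2 _ (by linarith)))
  obtain ⟨p, hp⟩ := hcl
  have hmeas : Measurable (fun y : FX (m + 2) n => (suppX (m + 2) n N1 ×ˢ suppX (m + 2) n N2).indicator
      (fun ω => h (sqX ω.1 + sqX ω.2)) (κ - y, y)) := by
    have e1 : Measurable ((suppX (m + 2) n N1 ×ˢ suppX (m + 2) n N2).indicator
      (fun ω => h (sqX ω.1 + sqX ω.2))) :=
      (hh.comp ((sqX_meas.comp measurable_fst).add (sqX_meas.comp measurable_snd))).indicator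
        ((suppX_meas _ _ _).prod (suppX_meas _ _ _))
    exact e1.comp ((measurable_const.sub measurable_id).prodMk measurable_id)
  rw [muX_lint _ hmeas]
  calc _ ≤ ∑ j ∈ F, ∫⁻ ζ, {ζ : Fin (m + 2) → ℝ | ∀ a, |ζ a| ≤ 2 * N2}.indicator
        (fun ζ => h ((∑ a, ((κ.1 a - ζ a) ^ 2 + ζ a ^ 2)) + A j)) ζ := by
        refine tsum_le_fin _ _ _ (fun j hj => ?_) (fun j hj => ?_)
        · refine le_antisymm (lint_zero_le fun ζ => ?_) zero_le
          refine Set.indicator_of_notMem (fun hc => hj ?_) _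
          exact suppX_snd (by linarith) hc.2
        · refine lintegral_mono fun ζ => ?_
          by_cases hc : (κ - (ζ, j), ((ζ, j) : FX (m + 2) n)) ∈ suppX (m + 2) n N1 ×ˢ suppX (m + 2) n N2
          · rw [Set.indicator_of_mem hc, Set.indicator_of_mem]
            · refine le_of_eq (congrArg h ?_)
              unfold sqX
              simp only [hAdef, Prod.fst_sub, Prod.snd_sub, Pi.sub_apply, Int.cast_sub, Finset.sum_add_distrib]
              ring
            · exact fun a => suppX_fst (by linarith) hc.2 a
          · rw [Set.indicator_of_notMem hc]; exact zero_le
    _ ≤ _ := bil_level F A κ.1 p hρ (by linarith) (by positivity) hp h hh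
    _ ≤ _ := by
        refine mul_le_mul_left (ENNReal.ofReal_le_ofReal ?_) _
        refine cB_bound hn hd h2 (card_ibox h2) (Real.sqrt_nonneg _) hs hθ0 (by positivity) ?_
        rw [← mul_pow]; congr 1; ring

set_option maxHeartbeats 1000000 in
lemma tri_M {n : ℕ} (hn : 1 ≤ n) {N1 N2 N3 : ℝ} (h3 : 1 ≤ N3) (h32 : N3 ≤ N2) (h21 : N2 ≤ N1) (κ : FX 1 n)
    (h : ℝ → ℝ≥0∞) (hh : Measurable h) :
    ∫⁻ y, (suppX 1 n N1 ×ˢ (suppX 1 n N2 ×ˢ suppX 1 n N3)).indicator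
        (fun ω => h (sqX ω.1 + (sqX ω.2.1 + sqX ω.2.2)))
        (κ - (y.1 + y.2), y) ∂((muX 1 n).prod (muX 1 n)) ≤
      ENNReal.ofReal (cB (5 ^ n) ((1 : ℕ) + n) n * (N3 ^ n * N2 ^ n) * (N3 / N1 + 1 / N2) ^ (1 / 8 : ℝ)) * ∫⁻ s, h s := by
  set d : ℝ := ((1 : ℕ) + n : ℝ) with hdd
  have h2 : 1 ≤ N2 := h3.trans h32
  have hd : 1 ≤ d := by rw [hdd]; push_cast; linarith [Nat.cast_nonneg (α := ℝ) n]
  obtain ⟨ρ, hρ, hs, hA, hB⟩ := num_params hd h3 h32 h21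
  set θ := (N3 / N1 + 1 / N2) ^ (1 / 8 : ℝ) with hθ
  have hN1' : 0 < N1 := by linarith
  have hN2' : 0 < N2 := by linarith
  have hθ0 : 0 ≤ θ := by positivity
  have hcK : 0 ≤ cK d := by unfold cK cZ; positivity
  set F := ibox n N2 with hF
  set A : (Fin n → ℤ) → (Fin n → ℤ) → ℝ := fun j3 j =>
    (∑ a, ((j a : ℝ) ^ 2 + (((κ.2 a : ℝ) - j3 a) - j a) ^ 2)) + ∑ a, (j3 a : ℝ) ^ 2 with hAdef
  set S := (suppX 1 n N1 ×ˢ (suppX 1 n N2 ×ˢ suppX 1 n N3)) with hS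
  by_cases hex : ∃ y : FX 1 n × FX 1 n, (κ - (y.1 + y.2), y) ∈ S
  swap
  · push Not at hex
    exact lint_zero_le fun y => Set.indicator_of_notMem (hex y) _
  have hcl : ∀ j3 ∈ ibox n N3, ρ ≤ |κ.1 0| / 3 - 2 * N3 ∨
      ∀ s, ((F.filter fun j => A j3 j ≤ s ∧ s < A j3 j + ρ ^ 2).card : ℝ) ≤
        cK d * N2 * θ * (5 * N2) ^ (n - 1) := by
    intro j3 hj3
    rcases lt_or_ge N1 (cZ d * N2) with hlt | hge
    · refine Or.inr fun s => ?_
      exact count_window ⟨0, hn⟩ h2 (by positivity) hρ.le (fun a => (κ.2 a : ℝ) - j3 a) (A j3) _ (fun j => rfl)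
        (Or.inr (hA hlt))
    · obtain ⟨y, hy1, hy2, hy3⟩ := hex
      have hl := sqX_large hd h2 hge hy1 (by
        have e1 := hy2.1
        have e2 := hy3.1
        have e3 := sqX_add_le y.1 y.2
        simp only at e1 e2
        nlinarith)
      obtain ⟨hB1, hB2⟩ := hB hge
      have hN1 : 0 ≤ N1 / 4 := by linarith
      rcases coord_sel (by omega) κ hN1 hl with ⟨p, hp⟩ | ⟨i, hi⟩
      · refine Or.inl ?_
        rw [Subsingleton.elim p 0] at hp
        have e1 : N1 / 4 / d ≤ |κ.1 0| := hp
        linarith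
      · refine Or.inr fun s => ?_
        have e1 : N1 / 4 / d ≤ |(κ.2 i : ℝ)| := hi
        have e2 := mem_ibox.mp hj3 i
        have e3 : |(κ.2 i : ℝ)| - |(j3 i : ℝ)| ≤ |(κ.2 i : ℝ) - j3 i| := abs_sub_abs_le_abs_sub _ _
        exact count_window i h2 (by positivity) hρ.le (fun a => (κ.2 a : ℝ) - j3 a) (A j3) _ (fun j => rfl)
          (Or.inl (hB2 _ (by linarith)))
  have hmeas : Measurable (fun y : FX 1 n × FX 1 n => S.indicator
      (fun ω => h (sqX ω.1 + (sqX ω.2.1 + sqX ω.2.2))) (κ - (y.1 + y.2), y)) := by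
    have e1 : Measurable (S.indicator (fun ω => h (sqX ω.1 + (sqX ω.2.1 + sqX ω.2.2)))) :=
      (hh.comp ((sqX_meas.comp measurable_fst).add ((sqX_meas.comp (measurable_fst.comp measurable_snd)).add
        (sqX_meas.comp (measurable_snd.comp measurable_snd))))).indicator
        ((suppX_meas _ _ _).prod ((suppX_meas _ _ _).prod (suppX_meas _ _ _)))
    exact e1.comp ((measurable_const.sub (measurable_fst.add measurable_snd)).prodMk measurable_id)
  have hpw : ∀ u v j2 j3, S.indicator (fun ω => h (sqX ω.1 + (sqX ω.2.1 + sqX ω.2.2)))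
      (κ - (((fun _ => u, j2) : FX 1 n) + ((fun _ => v, j3) : FX 1 n)), ((fun _ => u, j2), (fun _ => v, j3))) ≤
      (Set.Icc (-(2 * N3)) (2 * N3)).indicator
        (fun v => h (((κ.1 0 - (u + v)) ^ 2 + u ^ 2 + v ^ 2) + A j3 j2)) v := by
    intro u v j2 j3
    by_cases hc : (κ - (((fun _ => u, j2) : FX 1 n) + ((fun _ => v, j3) : FX 1 n)),
        (((fun _ => u, j2) : FX 1 n), ((fun _ => v, j3) : FX 1 n))) ∈ S
    · rw [Set.indicator_of_mem hc, Set.indicator_of_mem]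
      · refine le_of_eq (congrArg h ?_)
        unfold sqX
        simp only [hAdef, Prod.fst_sub, Prod.snd_sub, Prod.fst_add, Prod.snd_add, Pi.sub_apply, Pi.add_apply,
          Int.cast_sub, Int.cast_add, Finset.sum_add_distrib, Fin.sum_univ_one, sub_sub]
        have : ∀ a, ((κ.2 a : ℝ) - ((j2 a : ℝ) + j3 a)) = ((κ.2 a : ℝ) - ((j3 a : ℝ) + j2 a)) := fun a => by ring
        simp only [this]
        ring
      · exact abs_le.mp (suppX_fst (by linarith) hc.2.2 0)
    · rw [Set.indicator_of_notMem hc]; exact zero_le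
  have hin := tri_int _ hmeas F (ibox n N3) (Set.Icc (-(2 * N3)) (2 * N3)) measurableSet_Icc
    (fun u v j2 j3 => h (((κ.1 0 - (u + v)) ^ 2 + u ^ 2 + v ^ 2) + A j3 j2))
    (fun j2 j3 => hh.comp (by fun_prop))
    (fun y hy => Set.indicator_of_notMem (fun hc => hy (suppX_snd (by linarith) hc.2.1)) _)
    (fun y hy => Set.indicator_of_notMem (fun hc => hy (suppX_snd (by linarith) hc.2.2)) _) hpw
  refine hin.trans ?_
  calc _ ≤ ∑ j3 ∈ ibox n N3, ENNReal.ofReal (2 * Real.pi * (F.card * Real.sqrt (2 * (2 * N3) / ρ) +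
          cK d * N2 * θ * (5 * N2) ^ (n - 1))) * ∫⁻ s, h s := by
        refine Finset.sum_le_sum fun j hj => ?_
        exact tri_level F (A j) (κ.1 0) hρ (by linarith) (by positivity) (hcl j hj) h hh
    _ = ENNReal.ofReal ((ibox n N3).card * (2 * Real.pi * (F.card * Real.sqrt (2 * (2 * N3) / ρ) +
          cK d * N2 * θ * (5 * N2) ^ (n - 1)))) * ∫⁻ s, h s := by
        rw [Finset.sum_const, nsmul_eq_mul, ENNReal.ofReal_mul (p := ((ibox n N3).card : ℝ)) (by positivity),
          ENNReal.ofReal_natCast]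
        ring
    _ ≤ ENNReal.ofReal ((5 * N3) ^ n * (2 * Real.pi * (F.card * Real.sqrt (2 * (2 * N3) / ρ) +
          cK d * N2 * θ * (5 * N2) ^ (n - 1)))) * ∫⁻ s, h s := by
        gcongr
        exact card_ibox h3
    _ ≤ _ := by
        refine mul_le_mul_left (ENNReal.ofReal_le_ofReal ?_) _
        refine cB_bound hn hd h2 (card_ibox h2) (Real.sqrt_nonneg _) hs hθ0 (by positivity) ?_
        rw [← mul_pow]


lemma nice_data {m n : ℕ} {N : ℝ} (hN : 1 ≤ N) (g : (Fin m → ℝ) → (Fin n → ℤ) → ℂ)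
    (hg : SuppIn 1 g N) :
    ∃ G : FX m n → ℂ, Measurable G ∧ (∀ κ, κ ∉ suppX m n N → G κ = 0) ∧ Integrable G (muX m n) ∧
      (∀ t x y, waveU 1 g t x y = ∫ κ, G κ * ew (t, (x, y)) κ (sqX κ) ∂(muX m n)) ∧
      ∫⁻ κ, ‖G κ‖ₑ ^ 2 ∂(muX m n) ≤ l2sq 1 g := by
  have hN0 : 0 ≤ N := by linarith
  have hsupp : ∀ ζ j, (ζ, j) ∉ suppX m n N → g ζ j = 0 := by
    intro ζ j h
    by_contra hc
    apply h
    obtain ⟨h1, h2⟩ := hg ζ j hc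
    rw [freqNorm_eq (ζ, j)] at h1 h2
    have h0 := Real.sq_sqrt (sqX_nonneg (ζ, j))
    have h00 := Real.sqrt_nonneg (sqX (ζ, j))
    constructor
    · nlinarith
    · intro h3
      have := h2 h3
      nlinarith
  set H : (Fin n → ℤ) → (Fin m → ℝ) → ℂ := fun j =>
    if hI : Integrable (fun ζ => g ζ j) then hI.1.mk _ else 0 with hH
  have hHm : ∀ j, Measurable (H j) := by
    intro j
    simp only [hH]
    split_ifs with hI
    · exact hI.1.stronglyMeasurable_mk.measurable
    · exact measurable_const
  set G : FX m n → ℂ := (suppX m n N).indicator (fun κ => H κ.2 κ.1) with hG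
  have hGm : Measurable G := by
    refine Measurable.indicator ?_ (suppX_meas m n N)
    exact measurable_from_prod_countable_left (fun j => hHm j)
  have hG0 : ∀ κ, κ ∉ suppX m n N → G κ = 0 := fun κ h => Set.indicator_of_notMem h _
  have hGi : ∀ j, Integrable (fun ζ => g ζ j) → (fun ζ => G (ζ, j)) =ᵐ[volume] fun ζ => g ζ j := by
    intro j hI
    filter_upwards [hI.1.ae_eq_mk] with ζ hζ
    by_cases h : (ζ, j) ∈ suppX m n N
    · rw [hG, Set.indicator_of_mem h, hζ]
      simp only [hH, dif_pos hI]
    · rw [hG0 _ h, hsupp _ _ h]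
  have hGn : ∀ j, ¬ Integrable (fun ζ => g ζ j) → ∀ ζ, G (ζ, j) = 0 := by
    intro j hI ζ
    by_cases h : (ζ, j) ∈ suppX m n N
    · rw [hG, Set.indicator_of_mem h]
      simp only [hH, dif_neg hI]; rfl
    · exact hG0 _ h
  have hGI : Integrable G (muX m n) := by
    refine ⟨hGm.aestronglyMeasurable, ?_⟩
    unfold HasFiniteIntegral
    rw [muX_lint _ hGm.enorm, tsum_eq_sum (s := ibox n N)]
    · refine ENNReal.sum_lt_top.2 fun j _ => ?_
      by_cases hI : Integrable (fun ζ => g ζ j)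
      · rw [lintegral_congr_ae ((hGi j hI).mono fun ζ h => by simp only [h] : _ =ᵐ[volume] fun ζ => ‖g ζ j‖ₑ)]
        exact hI.2
      · simp [hGn j hI]
    · intro j hj
      have : ∀ ζ, G (ζ, j) = 0 := fun ζ => hG0 _ fun h => hj (suppX_snd hN0 h)
      simp [this]
  refine ⟨G, hGm, hG0, hGI, ?_, ?_⟩
  · intro t x y
    have hem : Measurable fun κ : FX m n => ew (t, (x, y)) κ (sqX κ) :=
      ew_meas' measurable_const measurable_id sqX_meas
    have hi : Integrable (fun κ => G κ * ew (t, (x, y)) κ (sqX κ)) (muX m n) := by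
      refine hGI.mono (hGm.mul hem).aestronglyMeasurable (Filter.Eventually.of_forall fun κ => ?_)
      rw [norm_mul, ew_norm, mul_one]
    unfold muX at hi ⊢
    rw [integral_prod_symm _ hi, integral_countable' hi.integral_prod_right]
    unfold waveU
    simp only [one_pow, div_one, Complex.ofReal_one, one_mul]
    refine tsum_congr fun j => ?_
    rw [measureReal_def, Measure.count_singleton, ENNReal.toReal_one, one_smul]
    by_cases hI : Integrable (fun ζ => g ζ j)
    · refine integral_congr_ae ?_
      filter_upwards [hGi j hI] with ζ h
      simp only [h]
      rfl
    · rw [integral_undef]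
      · simp [hGn j hI]
      · intro hc
        apply hI
        have hem2 : Measurable fun ζ : Fin m → ℝ => (starRingEnd ℂ) (ew (t, (x, y)) (ζ, j) (sqX (ζ, j))) :=
          Complex.continuous_conj.measurable.comp (hem.comp (measurable_id.prodMk measurable_const))
        have := hc.mul_bdd (c := 1) hem2.aestronglyMeasurable
          (Filter.Eventually.of_forall fun ζ => by
            rw [RCLike.norm_conj, ew_norm])
        refine this.congr (Filter.Eventually.of_forall fun ζ => ?_)
        have e := Complex.mul_conj (ew (t, (x, y)) (ζ, j) (sqX (ζ, j)))
        rw [Complex.normSq_eq_norm_sq, ew_norm] at e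
        have : g ζ j * (ew (t, (x, y)) (ζ, j) (sqX (ζ, j)) * (starRingEnd ℂ) (ew (t, (x, y)) (ζ, j) (sqX (ζ, j)))) = g ζ j := by
          rw [e]; simp
        rw [← mul_assoc] at this
        exact this
  · rw [muX_lint _ (hGm.enorm.pow_const 2)]
    unfold l2sq
    simp only [one_pow, div_one, ENNReal.ofReal_one, one_mul]
    refine ENNReal.tsum_le_tsum fun j => ?_
    by_cases hI : Integrable (fun ζ => g ζ j)
    · refine le_of_eq (lintegral_congr_ae ?_)
      filter_upwards [hGi j hI] with ζ h
      simp only [h]; rfl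
    · simp [hGn j hI]


/-- regularised Fourier data -/
def NiceX (m n : ℕ) (N : ℝ) (G : FX m n → ℂ) : Prop :=
  Measurable G ∧ (∀ κ, κ ∉ suppX m n N → G κ = 0) ∧ Integrable G (muX m n)

/-- wave of regularised data -/
def wvX {m n : ℕ} (G : FX m n → ℂ) (z : ZZ m n) : ℂ := ∫ κ, G κ * ew z κ (sqX κ) ∂(muX m n)

/-- squared norm -/
def nsX {m n : ℕ} (G : FX m n → ℂ) : ℝ≥0∞ := ∫⁻ κ, ‖G κ‖ₑ ^ 2 ∂(muX m n)

lemma wvX_meas {m n : ℕ} {G : FX m n → ℂ} (hG : Measurable G) : Measurable (wvX G) := by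
  unfold wvX
  have : StronglyMeasurable (fun p : ZZ m n × FX m n => G p.2 * ew p.1 p.2 (sqX p.2)) :=
    ((hG.comp measurable_snd).mul
      (ew_meas' measurable_fst measurable_snd (sqX_meas.comp measurable_snd))).stronglyMeasurable
  exact this.integral_prod_right.measurable

lemma lamZ_lint {m n : ℕ} (F : ZZ m n → ℝ≥0∞) (hF : Measurable F) :
    ∫⁻ t : ℝ, ∫⁻ x : Fin m → ℝ, ∫⁻ y in torusBox 1 n, F (t, (x, y)) = ∫⁻ z, F z ∂(lamZ m n) := by
  unfold lamZ torusBox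
  rw [lintegral_prod _ hF.aemeasurable]
  refine lintegral_congr fun t => ?_
  rw [lintegral_prod (fun y => F (t, y)) (hF.comp (measurable_const.prodMk measurable_id)).aemeasurable]

lemma bil_base {m n : ℕ} (hn : 1 ≤ n) {N1 N2 : ℝ} (h2 : 1 ≤ N2) (h21 : N2 ≤ N1)
    {G1 G2 : FX (m+2) n → ℂ} (hG1 : NiceX _ _ N1 G1) (hG2 : NiceX _ _ N2 G2) :
    ∫⁻ z, ‖wvX G1 z * wvX G2 z‖ₑ ^ 2 ∂(lamZ (m+2) n) ≤
      2 * (ENNReal.ofReal ((2*Real.pi)^((m+2)+n+1)) *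
        ENNReal.ofReal (cB (4^m) ((m+2:ℕ)+n) n * (N2^m * N2^n) * (N2/N1 + 1/N2)^(1/8:ℝ)))
        * (nsX G1 * nsX G2) := by
  have hf : Integrable (fun ω : FX (m+2) n × FX (m+2) n => G1 ω.1 * G2 ω.2)
      ((muX (m+2) n).prod (muX (m+2) n)) := hG1.2.2.mul_prod hG2.2.2
  have hfm : Measurable (fun ω : FX (m+2) n × FX (m+2) n => G1 ω.1 * G2 ω.2) :=
    (hG1.1.comp measurable_fst).mul (hG2.1.comp measurable_snd)
  have := core_bound (muX (m+2) n) (fun y => y) measurable_id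
    (fun ω => sqX ω.1 + sqX ω.2) ((sqX_meas.comp measurable_fst).add (sqX_meas.comp measurable_snd))
    (fun ω => G1 ω.1 * G2 ω.2) hf hfm (suppX (m+2) n N1 ×ˢ suppX (m+2) n N2)
    ((suppX_meas _ _ _).prod (suppX_meas _ _ _)) (by
      intro ω hω
      by_cases h : ω.1 ∈ suppX (m+2) n N1
      · have : ω.2 ∉ suppX (m+2) n N2 := fun h' => hω ⟨h, h'⟩
        simp only [hG2.2.1 _ this, mul_zero]
      · simp only [hG1.2.1 _ h, zero_mul]) _ (fun κ h hh => bil_M hn h2 h21 κ h hh)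
  refine le_trans (le_of_eq ?_) (le_trans this (le_of_eq ?_))
  · refine lintegral_congr fun z => ?_
    congr 2
    unfold wvX
    rw [← integral_prod_mul]
    refine integral_congr_ae (Filter.Eventually.of_forall fun ω => ?_)
    simp only [ew_add]
    ring
  · congr 1
    unfold nsX
    rw [← lintegral_prod_mul (hG1.1.enorm.pow_const 2).aemeasurable (hG2.1.enorm.pow_const 2).aemeasurable]
    refine lintegral_congr fun ω => ?_
    rw [enorm_mul, mul_pow]

lemma tri_base {n : ℕ} (hn : 1 ≤ n) {N1 N2 N3 : ℝ} (h3 : 1 ≤ N3) (h32 : N3 ≤ N2) (h21 : N2 ≤ N1)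
    {G1 G2 G3 : FX 1 n → ℂ} (hG1 : NiceX _ _ N1 G1) (hG2 : NiceX _ _ N2 G2) (hG3 : NiceX _ _ N3 G3) :
    ∫⁻ z, ‖wvX G1 z * (wvX G2 z * wvX G3 z)‖ₑ ^ 2 ∂(lamZ 1 n) ≤
      2 * (ENNReal.ofReal ((2*Real.pi)^(1+n+1)) *
        ENNReal.ofReal (cB (5^n) ((1:ℕ)+n) n * (N3^n * N2^n) * (N3/N1 + 1/N2)^(1/8:ℝ)))
        * (nsX G1 * (nsX G2 * nsX G3)) := by
  have hf2 : Integrable (fun ω : FX 1 n × FX 1 n => G2 ω.1 * G3 ω.2)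
      ((muX 1 n).prod (muX 1 n)) := hG2.2.2.mul_prod hG3.2.2
  have hfm2 : Measurable (fun ω : FX 1 n × FX 1 n => G2 ω.1 * G3 ω.2) :=
    (hG2.1.comp measurable_fst).mul (hG3.1.comp measurable_snd)
  have hf : Integrable (fun ω : FX 1 n × (FX 1 n × FX 1 n) => G1 ω.1 * (G2 ω.2.1 * G3 ω.2.2))
      ((muX 1 n).prod ((muX 1 n).prod (muX 1 n))) := hG1.2.2.mul_prod hf2
  have hfm : Measurable (fun ω : FX 1 n × (FX 1 n × FX 1 n) => G1 ω.1 * (G2 ω.2.1 * G3 ω.2.2)) :=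
    (hG1.1.comp measurable_fst).mul (hfm2.comp measurable_snd)
  have := core_bound ((muX 1 n).prod (muX 1 n)) (fun y => y.1 + y.2) (measurable_fst.add measurable_snd)
    (fun ω => sqX ω.1 + (sqX ω.2.1 + sqX ω.2.2))
    ((sqX_meas.comp measurable_fst).add ((sqX_meas.comp (measurable_fst.comp measurable_snd)).add
      (sqX_meas.comp (measurable_snd.comp measurable_snd))))
    (fun ω => G1 ω.1 * (G2 ω.2.1 * G3 ω.2.2)) hf hfm
    (suppX 1 n N1 ×ˢ (suppX 1 n N2 ×ˢ suppX 1 n N3))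
    ((suppX_meas _ _ _).prod ((suppX_meas _ _ _).prod (suppX_meas _ _ _))) (by
      intro ω hω
      by_cases h : ω.1 ∈ suppX 1 n N1
      · by_cases h' : ω.2.1 ∈ suppX 1 n N2
        · have : ω.2.2 ∉ suppX 1 n N3 := fun h'' => hω ⟨h, h', h''⟩
          simp only [hG3.2.1 _ this, mul_zero]
        · simp only [hG2.2.1 _ h', mul_zero, zero_mul]
      · simp only [hG1.2.1 _ h, zero_mul]) _ (fun κ h hh => tri_M hn h3 h32 h21 κ h hh)
  refine le_trans (le_of_eq ?_) (le_trans this (le_of_eq ?_))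
  · refine lintegral_congr fun z => ?_
    congr 2
    unfold wvX
    rw [← integral_prod_mul, ← integral_prod_mul]
    refine integral_congr_ae (Filter.Eventually.of_forall fun ω => ?_)
    simp only [ew_add]
    ring
  · congr 1
    unfold nsX
    rw [← lintegral_prod_mul (hG2.1.enorm.pow_const 2).aemeasurable (hG3.1.enorm.pow_const 2).aemeasurable,
      ← lintegral_prod_mul (g := fun z : FX 1 n × FX 1 n => ‖G2 z.1‖ₑ ^ 2 * ‖G3 z.2‖ₑ ^ 2)
        (hG1.1.enorm.pow_const 2).aemeasurable
      (((hG2.1.comp measurable_fst).enorm.pow_const 2).mul ((hG3.1.comp measurable_snd).enorm.pow_const 2)).aemeasurable]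
    refine lintegral_congr fun ω => ?_
    simp only [enorm_mul, mul_pow]

lemma suppX_vol (m n : ℕ) {N : ℝ} (hN : 1 ≤ N) :
    muX m n (suppX m n N) ≤ ENNReal.ofReal ((4*N)^m * (5*N)^n) := by
  have hN0 : 0 ≤ N := by linarith
  have hsub : suppX m n N ⊆ {w : Fin m → ℝ | ∀ a, |w a| ≤ 2*N} ×ˢ (ibox n N : Set (Fin n → ℤ)) :=
    fun κ h => ⟨fun a => suppX_fst hN0 h a, suppX_snd hN0 h⟩
  refine (measure_mono hsub).trans ?_
  unfold muX
  rw [Measure.prod_prod, Measure.count_apply_finset, ENNReal.ofReal_mul (by positivity)]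
  refine mul_le_mul' ?_ ?_
  · refine (box_vol m (by linarith)).trans (le_of_eq ?_)
    congr 2; ring
  · rw [← ENNReal.ofReal_natCast]
    exact ENNReal.ofReal_le_ofReal (card_ibox hN)

lemma wvX_sup {m n : ℕ} {N : ℝ} (hN : 1 ≤ N) {G : FX m n → ℂ} (hG : NiceX m n N G) (z : ZZ m n) :
    ‖wvX G z‖ₑ ≤ ENNReal.ofReal (20^(m+n) * N^(((m:ℝ)+n)/2)) * (nsX G)^(1/2:ℝ) := by
  have hN0 : 0 ≤ N := by linarith
  have h1 : ‖wvX G z‖ₑ ≤ ∫⁻ κ, ‖G κ‖ₑ ∂(muX m n) := by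
    refine (enorm_integral_le_lintegral_enorm _).trans (le_of_eq ?_)
    refine lintegral_congr fun κ => ?_
    rw [enorm_mul, ← ofReal_norm (ew _ _ _), ew_norm]; simp
  have h2 : ∫⁻ κ, ‖G κ‖ₑ ∂(muX m n) =
      ∫⁻ κ, ((suppX m n N).indicator (fun _ => (1:ℝ≥0∞)) * fun κ => ‖G κ‖ₑ) κ ∂(muX m n) := by
    refine lintegral_congr fun κ => ?_
    by_cases h : κ ∈ suppX m n N
    · simp [h]
    · simp [h, hG.2.1 _ h]
  have h3 := ENNReal.lintegral_mul_le_Lp_mul_Lq (muX m n) Real.HolderConjugate.two_two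
    (f := (suppX m n N).indicator (fun _ => (1:ℝ≥0∞))) (g := fun κ => ‖G κ‖ₑ)
    (measurable_const.indicator (suppX_meas m n N)).aemeasurable hG.1.enorm.aemeasurable
  rw [h2] at h1
  refine h1.trans (h3.trans ?_)
  refine mul_le_mul' ?_ (le_of_eq ?_)
  · have : ∫⁻ κ, (suppX m n N).indicator (fun _ => (1:ℝ≥0∞)) κ ^ (2:ℝ) ∂(muX m n) = muX m n (suppX m n N) := by
      rw [← lintegral_indicator_one (suppX_meas m n N)]
      refine lintegral_congr fun κ => ?_
      by_cases h : κ ∈ suppX m n N <;> simp [h]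
    rw [this]
    refine (ENNReal.rpow_le_rpow (suppX_vol m n hN) (by norm_num)).trans ?_
    rw [ENNReal.ofReal_rpow_of_nonneg (by positivity) (by norm_num)]
    refine ENNReal.ofReal_le_ofReal ?_
    calc ((4*N)^m * (5*N)^n) ^ (1/2:ℝ) ≤ ((20^(m+n))^2 * N^((m:ℝ)+n)) ^ (1/2:ℝ) := by
          refine Real.rpow_le_rpow (by positivity) ?_ (by norm_num)
          rw [show (m:ℝ)+n = ((m+n:ℕ):ℝ) by push_cast; ring, Real.rpow_natCast, pow_add N, mul_pow, mul_pow]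
          calc 4^m*N^m*(5^n*N^n) = (4^m*5^n)*(N^m*N^n) := by ring
            _ ≤ (20^(m+n))^2 * (N^m*N^n) := by
              gcongr
              calc (4:ℝ)^m*5^n ≤ 20^m*20^n := by gcongr <;> norm_num
                _ = 20^(m+n) := by ring
                _ ≤ _ := le_self_pow₀ (one_le_pow₀ (by norm_num)) (by norm_num)
      _ = _ := by
          rw [Real.mul_rpow (by positivity) (by positivity), ← Real.sqrt_eq_rpow, Real.sqrt_sq (by positivity),
            ← Real.rpow_mul hN0]
          congr 2; ring
  · unfold nsX
    congr 1
    refine lintegral_congr fun κ => ?_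
    rw [ENNReal.rpow_two]


/-- the estimate for regularised data -/
def NStmt (m n k : ℕ) : Prop :=
  ∃ δ C : ℝ, 0 < δ ∧ 0 < C ∧
    ∀ (N : Fin (k + 1) → ℝ) (G : Fin (k + 1) → FX m n → ℂ),
      (∀ i, 1 ≤ N i) → (∀ i j : Fin (k + 1), i ≤ j → N j ≤ N i) →
      (∀ i, NiceX m n (N i) (G i)) →
      (∫⁻ z, ‖∏ i, wvX (G i) z‖ₑ ^ 2 ∂(lamZ m n)) ^ (1 / 2 : ℝ)
        ≤ ENNReal.ofReal (C * (N (Fin.last k) / N 0 + 1 / N 1) ^ δ)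
            * (nsX (G 0)) ^ (1 / 2 : ℝ)
            * ∏ i : Fin k, (ENNReal.ofReal ((N i.succ) ^ (((m : ℝ) + n) / 2 - 1 / (k : ℝ)))
                * (nsX (G i.succ)) ^ (1 / 2 : ℝ))

lemma half_pow {a b : ℝ} (ha : 0 ≤ a) (hb : 0 ≤ b) (S : ℝ≥0∞) :
    (2 * (ENNReal.ofReal a * ENNReal.ofReal b) * S) ^ (1/2:ℝ) =
      ENNReal.ofReal ((2*(a*b))^(1/2:ℝ)) * S^(1/2:ℝ) := by
  rw [ENNReal.mul_rpow_of_nonneg _ _ (by norm_num), ← ENNReal.ofReal_mul ha,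
    show (2:ℝ≥0∞) = ENNReal.ofReal 2 by simp, ← ENNReal.ofReal_mul (by norm_num),
    ENNReal.ofReal_rpow_of_nonneg (by positivity) (by norm_num)]

lemma cB_pos {a d : ℝ} (n : ℕ) (ha : 0 < a) (hd : 1 ≤ d) : 0 < cB a d n := by
  unfold cB cK cZ
  positivity

lemma base_bil {m n : ℕ} (hn : 1 ≤ n) : NStmt (m+2) n 1 := by
  set A : ℝ := (2*Real.pi)^((m+2)+n+1) with hA
  set B : ℝ := cB (4^m) ((m+2:ℕ)+n) n with hB
  have hA0 : 0 < A := by positivity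
  have hB0 : 0 < B := cB_pos _ (by positivity) (by push_cast; linarith [Nat.cast_nonneg (α := ℝ) m, Nat.cast_nonneg (α := ℝ) n])
  refine ⟨1/16, (2*(A*B))^(1/2:ℝ), by norm_num, by positivity, ?_⟩
  intro N G hN hanti hG
  have h1 : 1 ≤ N 1 := hN 1
  have h0 : 1 ≤ N 0 := hN 0
  have hb := bil_base hn h1 (hanti 0 1 (by simp)) (hG 0) (hG 1)
  have hX : 0 ≤ N 1 / N 0 + 1 / N 1 := by positivity
  have e : (fun z => ‖∏ i : Fin 2, wvX (G i) z‖ₑ ^ 2) = fun z => ‖wvX (G 0) z * wvX (G 1) z‖ₑ ^ 2 := by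
    funext z; rw [Fin.prod_univ_two]
  rw [show (∫⁻ z, ‖∏ i : Fin (1+1), wvX (G i) z‖ₑ ^ 2 ∂(lamZ (m+2) n)) =
    ∫⁻ z, ‖wvX (G 0) z * wvX (G 1) z‖ₑ ^ 2 ∂(lamZ (m+2) n) from congrArg _ e]
  refine (ENNReal.rpow_le_rpow hb (by norm_num)).trans (le_of_eq ?_)
  rw [half_pow (by positivity) (by positivity), ENNReal.mul_rpow_of_nonneg _ _ (by norm_num)]
  rw [Fin.prod_univ_one]
  change _ = ENNReal.ofReal (_ * (N 1 / N 0 + 1 / N 1) ^ (1/16:ℝ)) * _ * (ENNReal.ofReal (N 1 ^ _) * nsX (G 1) ^ (1/2:ℝ))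
  rw [show ∀ a b c d : ℝ≥0∞, a * b * (c * d) = (a * c) * (b * d) by intros; ring,
    ← ENNReal.ofReal_mul (by positivity)]
  congr 2
  have e1 : N 1 ^ m * N 1 ^ n = N 1 ^ ((m:ℝ)+n) := by
    rw [← pow_add, ← Real.rpow_natCast]; push_cast; rfl
  rw [e1, show 2 * (A * (B * N 1 ^ ((m:ℝ)+n) * (N 1 / N 0 + 1 / N 1) ^ (1/8:ℝ))) =
    (2*(A*B)) * (N 1 / N 0 + 1 / N 1) ^ (1/8:ℝ) * N 1 ^ ((m:ℝ)+n) by ring,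
    Real.mul_rpow (by positivity) (by positivity), Real.mul_rpow (by positivity) (by positivity),
    ← Real.rpow_mul hX, ← Real.rpow_mul (by linarith)]
  congr 2
  · norm_num
  · push_cast; ring

lemma base_tri {n : ℕ} (hn : 1 ≤ n) : NStmt 1 n 2 := by
  set A : ℝ := (2*Real.pi)^(1+n+1) with hA
  set B : ℝ := cB (5^n) ((1:ℕ)+n) n with hB
  have hA0 : 0 < A := by positivity
  have hB0 : 0 < B := cB_pos _ (by positivity) (by push_cast; linarith [Nat.cast_nonneg (α := ℝ) n])
  refine ⟨1/16, (2*(A*B))^(1/2:ℝ), by norm_num, by positivity, ?_⟩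
  intro N G hN hanti hG
  have h2 : 1 ≤ N 2 := hN 2
  have h1 : 1 ≤ N 1 := hN 1
  have h0 : 1 ≤ N 0 := hN 0
  have hb := tri_base hn h2 (hanti 1 2 (by decide)) (hanti 0 1 (by decide)) (hG 0) (hG 1) (hG 2)
  have hX : 0 ≤ N 2 / N 0 + 1 / N 1 := by positivity
  have e : (fun z => ‖∏ i : Fin 3, wvX (G i) z‖ₑ ^ 2) = fun z => ‖wvX (G 0) z * (wvX (G 1) z * wvX (G 2) z)‖ₑ ^ 2 := by
    funext z; rw [Fin.prod_univ_three, mul_assoc]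
  rw [show (∫⁻ z, ‖∏ i : Fin (2+1), wvX (G i) z‖ₑ ^ 2 ∂(lamZ 1 n)) =
    ∫⁻ z, ‖wvX (G 0) z * (wvX (G 1) z * wvX (G 2) z)‖ₑ ^ 2 ∂(lamZ 1 n) from congrArg _ e]
  refine (ENNReal.rpow_le_rpow hb (by norm_num)).trans (le_of_eq ?_)
  rw [half_pow (by positivity) (by positivity), ENNReal.mul_rpow_of_nonneg _ _ (by norm_num),
    ENNReal.mul_rpow_of_nonneg _ _ (by norm_num)]
  rw [Fin.prod_univ_two]
  change _ = ENNReal.ofReal (_ * (N 2 / N 0 + 1 / N 1) ^ (1/16:ℝ)) * _ * ((ENNReal.ofReal (N 1 ^ _) * nsX (G 1) ^ (1/2:ℝ)) * (ENNReal.ofReal (N 2 ^ _) * nsX (G 2) ^ (1/2:ℝ)))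
  rw [show ∀ a b c d e f : ℝ≥0∞, a * b * ((c * d) * (e * f)) = (a * c * e) * (b * (d * f)) by intros; ring,
    ← ENNReal.ofReal_mul (by positivity), ← ENNReal.ofReal_mul (by positivity)]
  congr 2
  rw [← Real.rpow_natCast (N 2) n, ← Real.rpow_natCast (N 1) n, show 2 * (A * (B * (N 2 ^ (n:ℝ) * N 1 ^ (n:ℝ)) * (N 2 / N 0 + 1 / N 1) ^ (1/8:ℝ))) =
    (2*(A*B)) * (N 2 / N 0 + 1 / N 1) ^ (1/8:ℝ) * N 1 ^ (n:ℝ) * N 2 ^ (n:ℝ) by ring,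
    Real.mul_rpow (by positivity) (by positivity), Real.mul_rpow (by positivity) (by positivity),
    Real.mul_rpow (by positivity) (by positivity),
    ← Real.rpow_mul hX, ← Real.rpow_mul (by linarith), ← Real.rpow_mul (by linarith)]
  congr 2
  · congr 2
    norm_num
  · push_cast; ring
  · push_cast; ring

lemma step_real {k : ℕ} (hk : 1 ≤ k) {C δ D L P N0 N1 s : ℝ} (M : Fin k → ℝ) (hC : 0 < C) (hδ : 0 < δ)
    (hD : 0 < D) (hL : 1 ≤ L) (hLP : L ≤ P) (hM : ∀ i, P ≤ M i) (hP1 : P ≤ N0) (hN1 : 1 ≤ N1) :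
    C * (P / N0 + 1 / N1) ^ δ * (∏ i, (M i) ^ (s - 1 / (k:ℝ))) * (D * L ^ s) ≤
      (C * D * 2 ^ δ) * (L / N0 + 1 / N1) ^ (min δ (1 / ((k+1:ℕ):ℝ))) *
       ((∏ i, (M i) ^ (s - 1 / ((k+1:ℕ):ℝ))) * L ^ (s - 1 / ((k+1:ℕ):ℝ))) := by
  have hk0 : (0:ℝ) < k := by exact_mod_cast hk
  have hP : 0 < P := by linarith
  have hN0 : 0 < N0 := by linarith
  have hL0 : 0 < L := by linarith
  set q : ℝ := 1 / ((k+1:ℕ):ℝ) with hq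
  have hq0 : 0 < q := by positivity
  set e := min δ q with he
  have he0 : 0 < e := lt_min hδ hq0
  have hM0 : ∀ i, 0 < M i := fun i => hP.trans_le (hM i)
  have p1 : ∏ i, (M i) ^ (s - 1 / (k:ℝ)) ≤ (∏ i, (M i) ^ (s - q)) * P ^ (-q) := by
    have : ∀ i, (M i) ^ (s - 1 / (k:ℝ)) ≤ (M i) ^ (s - q) * P ^ (-(q / k)) := by
      intro i
      rw [show s - 1/(k:ℝ) = (s - q) + (-(q/k)) by
        rw [hq]; push_cast; field_simp; ring, Real.rpow_add (hM0 i)]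
      refine mul_le_mul_of_nonneg_left ?_ (Real.rpow_nonneg (hM0 i).le _)
      exact Real.rpow_le_rpow_of_nonpos hP (hM i) (by simp; positivity)
    refine (Finset.prod_le_prod (fun i _ => Real.rpow_nonneg (hM0 i).le _) fun i _ => this i).trans (le_of_eq ?_)
    rw [Finset.prod_mul_distrib, Finset.prod_const, Finset.card_univ, Fintype.card_fin, ← Real.rpow_natCast,
      ← Real.rpow_mul hP.le]
    congr 2; field_simp
  have p2 : (P / N0 + 1 / N1) ^ δ * (P ^ (-q) * L ^ q) ≤ 2 ^ δ * (L / N0 + 1 / N1) ^ e := by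
    set X := P / N0 + 1 / N1 with hX
    have hX0 : 0 < X := by positivity
    have hX2 : X ≤ 2 := by
      have a1 : P / N0 ≤ 1 := (div_le_one hN0).2 hP1
      have a2 : 1 / N1 ≤ 1 := (div_le_one (by linarith)).2 hN1
      linarith
    have hr : P ^ (-q) * L ^ q = (L / P) ^ q := by
      rw [Real.div_rpow hL0.le hP.le, Real.rpow_neg hP.le]; field_simp
    have hr1 : L / P ≤ 1 := (div_le_one hP).2 hLP
    have b1 : (L / P) ^ q ≤ (L / P) ^ e := Real.rpow_le_rpow_of_exponent_ge (by positivity) hr1 (min_le_right _ _)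
    have b2 : X ^ δ ≤ 2 ^ δ * X ^ e := by
      rw [show X ^ δ = X ^ (δ - e) * X ^ e by rw [← Real.rpow_add hX0]; congr 1; ring]
      refine mul_le_mul_of_nonneg_right ?_ (by positivity)
      calc X ^ (δ - e) ≤ 2 ^ (δ - e) := Real.rpow_le_rpow hX0.le hX2 (sub_nonneg.2 (min_le_left _ _))
        _ ≤ 2 ^ δ := Real.rpow_le_rpow_of_exponent_le (by norm_num) (by linarith)
    have b3 : X * (L / P) ≤ L / N0 + 1 / N1 := by
      have : X * (L / P) = L / N0 + 1 / N1 * (L / P) := by rw [hX]; field_simp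
      rw [this]
      have : 1 / N1 * (L / P) ≤ 1 / N1 * 1 := mul_le_mul_of_nonneg_left hr1 (by positivity)
      linarith
    rw [hr]
    calc X ^ δ * (L / P) ^ q ≤ (2 ^ δ * X ^ e) * (L / P) ^ e := mul_le_mul b2 b1 (by positivity) (by positivity)
      _ = 2 ^ δ * (X * (L / P)) ^ e := by rw [Real.mul_rpow hX0.le (by positivity)]; ring
      _ ≤ _ := mul_le_mul_of_nonneg_left (Real.rpow_le_rpow (by positivity) b3 he0.le) (by positivity)
  have hprod : 0 ≤ ∏ i, (M i) ^ (s - q) := Finset.prod_nonneg fun i _ => Real.rpow_nonneg (hM0 i).le _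
  have hLs : L ^ s = L ^ (s - q) * L ^ q := by rw [← Real.rpow_add hL0]; congr 1; ring
  have hX0 : 0 ≤ P / N0 + 1 / N1 := by positivity
  calc _ ≤ C * (P / N0 + 1 / N1) ^ δ * ((∏ i, (M i) ^ (s - q)) * P ^ (-q)) * (D * L ^ s) := by
        refine mul_le_mul_of_nonneg_right (mul_le_mul_of_nonneg_left p1 (by positivity)) (by positivity)
    _ = (C * D * (∏ i, (M i) ^ (s - q)) * L ^ (s - q)) * ((P / N0 + 1 / N1) ^ δ * (P ^ (-q) * L ^ q)) := by
        rw [hLs]; ring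
    _ ≤ (C * D * (∏ i, (M i) ^ (s - q)) * L ^ (s - q)) * (2 ^ δ * (L / N0 + 1 / N1) ^ e) :=
        mul_le_mul_of_nonneg_left p2 (by positivity)
    _ = _ := by ring

lemma nstep {m n k : ℕ} (hk : 1 ≤ k) (h : NStmt m n k) : NStmt m n (k+1) := by
  obtain ⟨δ, C, hδ, hC, h⟩ := h
  refine ⟨min δ (1 / ((k+1:ℕ):ℝ)), C * 20^(m+n) * 2 ^ δ, lt_min hδ (by positivity), by positivity, ?_⟩
  intro N G hN hanti hG
  set s : ℝ := ((m:ℝ)+n)/2 with hs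
  set N' : Fin (k+1) → ℝ := fun i => N i.castSucc with hN'
  set G' : Fin (k+1) → FX m n → ℂ := fun i => G i.castSucc with hG'
  have ih := h N' G' (fun i => hN _) (fun i j hij => hanti _ _ (Fin.castSucc_le_castSucc_iff.2 hij)) (fun i => hG _)
  set L := N (Fin.last (k+1)) with hLd
  set c : ℝ≥0∞ := ENNReal.ofReal (20^(m+n) * L ^ s) * (nsX (G (Fin.last (k+1)))) ^ (1/2:ℝ) with hc
  have hL1 : 1 ≤ L := hN _
  have one : (1 : Fin (k+1+1)) = (1 : Fin (k+1)).castSucc := by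
    ext; simp
    rw [Nat.mod_eq_of_lt (by omega)]
  have i0 : (∫⁻ z, ‖∏ i, wvX (G i) z‖ₑ ^ 2 ∂(lamZ m n)) ^ (1 / 2 : ℝ) ≤
      (∫⁻ z, ‖∏ i, wvX (G' i) z‖ₑ ^ 2 ∂(lamZ m n)) ^ (1 / 2 : ℝ) * c := by
    have : ∫⁻ z, ‖∏ i, wvX (G i) z‖ₑ ^ 2 ∂(lamZ m n) ≤
        (∫⁻ z, ‖∏ i, wvX (G' i) z‖ₑ ^ 2 ∂(lamZ m n)) * c ^ 2 := by
      rw [← lintegral_mul_const _ ((Finset.measurable_prod _ fun i _ => wvX_meas (hG _).1).enorm.pow_const 2)]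
      refine lintegral_mono fun z => ?_
      simp only
      rw [Fin.prod_univ_castSucc, enorm_mul, mul_pow]
      refine mul_le_mul' le_rfl (pow_le_pow_left' (wvX_sup hL1 (hG _) z) 2)
    refine (ENNReal.rpow_le_rpow this (by norm_num)).trans (le_of_eq ?_)
    rw [ENNReal.mul_rpow_of_nonneg _ _ (by norm_num), ← ENNReal.rpow_natCast, ← ENNReal.rpow_mul]
    norm_num
  refine i0.trans ((mul_le_mul' ih le_rfl).trans ?_)
  rw [Fin.prod_univ_castSucc (n := k), Finset.prod_mul_distrib, Finset.prod_mul_distrib, hc,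
    ← ENNReal.ofReal_prod_of_nonneg (fun i _ => Real.rpow_nonneg (zero_le_one.trans (hN _)) _),
    ← ENNReal.ofReal_prod_of_nonneg (fun i _ => Real.rpow_nonneg (zero_le_one.trans (hN _)) _)]
  have key := step_real hk (s := s) (fun i : Fin k => N' i.succ) hC hδ (D := 20^(m+n)) (by positivity) hL1
    (P := N' (Fin.last k)) (N0 := N' 0) (N1 := N' 1) (hanti _ _ (Fin.le_last _))
    (fun i => hanti _ _ (Fin.castSucc_le_castSucc_iff.2 (Fin.le_last _)))
    (hanti _ _ (Fin.castSucc_le_castSucc_iff.2 (Fin.le_last _))) (hN _)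
  have n0 : ∀ i, 0 ≤ N i := fun i => zero_le_one.trans (hN i)
  have nX : 0 ≤ N' (Fin.last k) / N' 0 + 1 / N' 1 := by
    have := n0 (Fin.last k).castSucc; have := n0 (0 : Fin (k+1)).castSucc; have := n0 (1 : Fin (k+1)).castSucc
    simp only [hN']; positivity
  have nX2 : 0 ≤ L / N' 0 + 1 / N' 1 := by
    have := n0 (0 : Fin (k+1)).castSucc; have := n0 (1 : Fin (k+1)).castSucc
    simp only [hN']; positivity
  have nP : ∀ e : ℝ, 0 ≤ ∏ i : Fin k, N' i.succ ^ e := fun e =>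
    Finset.prod_nonneg fun i _ => Real.rpow_nonneg (n0 _) _
  have key2 := ENNReal.ofReal_le_ofReal key
  rw [ENNReal.ofReal_mul (mul_nonneg (mul_nonneg hC.le (Real.rpow_nonneg nX _)) (nP _)),
    ENNReal.ofReal_mul (mul_nonneg hC.le (Real.rpow_nonneg nX _)),
    ENNReal.ofReal_mul (mul_nonneg (by positivity) (Real.rpow_nonneg nX2 _)),
    ENNReal.ofReal_mul (nP _)] at key2
  set S0 := nsX (G 0) ^ (1/2:ℝ)
  set SL := nsX (G (Fin.last (k+1))) ^ (1/2:ℝ)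
  set SP := ∏ i : Fin k, nsX (G' i.succ) ^ (1/2:ℝ)
  have fin := mul_le_mul' key2 (le_refl (S0 * SP * SL))
  refine le_trans (le_of_eq ?_) (fin.trans (le_of_eq ?_))
  · change ENNReal.ofReal _ * S0 * (ENNReal.ofReal _ * SP) * (_ * SL) = _
    ring
  · rw [one]
    change _ = ENNReal.ofReal (_ * (L / N' 0 + 1 / N' 1) ^ _) * S0 * ((_ * SP) * (ENNReal.ofReal (L ^ _) * SL))
    simp only [Fin.succ_castSucc]
    ring


lemma nstmt_all (m n k : ℕ)
    (hcase : (2 ≤ m ∧ 1 ≤ n ∧ 1 ≤ k) ∨ (m = 1 ∧ 2 ≤ n ∧ 2 ≤ k)) : NStmt m n k := by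
  rcases hcase with ⟨hm, hn, hk⟩ | ⟨hm, hn, hk⟩
  · obtain ⟨m, rfl⟩ := Nat.exists_eq_add_of_le' hm
    induction k, hk using Nat.le_induction with
    | base => exact base_bil hn
    | succ k hk ih => exact nstep hk ih
  · subst hm
    induction k, hk using Nat.le_induction with
    | base => exact base_tri (by omega)
    | succ k hk ih => exact nstep (by omega) ih

/-- **Global-in-time multilinear Strichartz estimate on the waveguide `ℝ^m × 𝕋ⁿ`.** -/
theorem multilinear_strichartz_global (m n k : ℕ)
    (hcase : (2 ≤ m ∧ 1 ≤ n ∧ 1 ≤ k) ∨ (m = 1 ∧ 2 ≤ n ∧ 2 ≤ k)) :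
    ∃ δ C : ℝ, 0 < δ ∧ 0 < C ∧
    ∀ (N : Fin (k + 1) → ℝ) (g : Fin (k + 1) → (Fin m → ℝ) → (Fin n → ℤ) → ℂ),
      (∀ i, IsDyadic (N i)) → (∀ i, 1 ≤ N i) →
      (∀ i j : Fin (k + 1), i ≤ j → N j ≤ N i) →
      (∀ i, SuppIn 1 (g i) (N i)) →
      (∫⁻ t : ℝ, ∫⁻ x : Fin m → ℝ, ∫⁻ y in torusBox 1 n,
          (‖∏ i : Fin (k + 1), waveU 1 (g i) t x y‖₊ : ℝ≥0∞) ^ 2) ^ (1 / 2 : ℝ)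
        ≤ ENNReal.ofReal (C * (N (Fin.last k) / N 0 + 1 / N 1) ^ δ)
            * (l2sq 1 (g 0)) ^ (1 / 2 : ℝ)
            * ∏ i : Fin k, (ENNReal.ofReal ((N i.succ) ^ (((m : ℝ) + n) / 2 - 1 / (k : ℝ)))
                * (l2sq 1 (g i.succ)) ^ (1 / 2 : ℝ)) := by
  obtain ⟨δ, C, hδ, hC, h⟩ := nstmt_all m n k hcase
  refine ⟨δ, C, hδ, hC, ?_⟩
  intro N g _ hN hanti hg
  choose G hGm hG0 hGI hGw hGl using fun i => nice_data (hN i) (g i) (hg i)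
  have hb := h N G hN hanti (fun i => ⟨hGm i, hG0 i, hGI i⟩)
  have hns : ∀ i, (nsX (G i)) ^ (1 / 2 : ℝ) ≤ (l2sq 1 (g i)) ^ (1 / 2 : ℝ) := fun i =>
    ENNReal.rpow_le_rpow (hGl i) (by norm_num)
  have e : (∫⁻ t : ℝ, ∫⁻ x : Fin m → ℝ, ∫⁻ y in torusBox 1 n,
      (‖∏ i : Fin (k + 1), waveU 1 (g i) t x y‖₊ : ℝ≥0∞) ^ 2) =
      ∫⁻ z, ‖∏ i, wvX (G i) z‖ₑ ^ 2 ∂(lamZ m n) := by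
    rw [← lamZ_lint _ ((Finset.measurable_prod _ fun i _ => wvX_meas (hGm i)).enorm.pow_const 2)]
    refine lintegral_congr fun t => lintegral_congr fun x => lintegral_congr fun y => ?_
    simp only [hGw]
    rfl
  rw [e]
  refine hb.trans ?_
  refine mul_le_mul' (mul_le_mul' le_rfl (hns 0)) ?_
  exact Finset.prod_le_prod' fun i _ => mul_le_mul' le_rfl (hns _)
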